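/- arXiv:2207.06756 — 8 statements merged into one kernel-verified Lean document; each statement's English description precedes it below -/
import Mathlib

section
/- Let α ≥ 1 and let f : [0,∞) → ℝ be twice continuously differentiable such that both f and f'' vanish at infinity. Then lim_{n→∞} sup_{x∈[0,∞)} w_α(x) · |n(𝒫ₙf(x) − f(x)) − 𝒜f(x)| = 0. -/
open Filter

/-- The Szász–Mirakyan operator `𝒫ₙ`:
`𝒫ₙ f (x) = ∑_{k=0}^∞ e^{-nx} (nx)^k / k! · f(k/n)`. -/
noncomputable def szasz (n : ℕ) (f : ℝ → ℝ) (x : ℝ) : ℝ :=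
  ∑' k : ℕ, Real.exp (-((n : ℝ) * x)) * ((n : ℝ) * x) ^ k / (Nat.factorial k) *
    f ((k : ℝ) / (n : ℝ))

/-- The weight function `w_α(x) = 1 / (1 + x^α)`. -/
noncomputable def wt (α : ℝ) (x : ℝ) : ℝ := 1 / (1 + x ^ α)

/-- The degenerate differential operator `𝒜 f (x) = (x/2) f''(x)` for `x > 0`, `𝒜 f (0) = 0`,
where `f''` is the second derivative of `f` on `[0, ∞)`. -/
noncomputable def opA (f : ℝ → ℝ) (x : ℝ) : ℝ :=
  x / 2 * iteratedDerivWithin 2 f (Set.Ici 0) x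

/-- The factorial moments of the Poisson distribution. -/
theorem hasSum_poisson_descFactorial (l : ℝ) (j : ℕ) :
    HasSum (fun k : ℕ => Real.exp (-l) * l ^ k / k.factorial * (k.descFactorial j : ℝ))
      (l ^ j) := by
  have hexp : HasSum (fun k : ℕ => l ^ k / k.factorial) (Real.exp l) := by
    rw [Real.exp_eq_exp_ℝ]
    exact NormedSpace.expSeries_div_hasSum_exp l
  have hmul := hexp.mul_left (Real.exp (-l) * l ^ j)
  have hval : Real.exp (-l) * l ^ j * Real.exp l = l ^ j := by
    rw [mul_right_comm, ← Real.exp_add]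
    simp
  rw [hval] at hmul
  rw [← hasSum_nat_add_iff' j, Finset.sum_eq_zero, sub_zero]
  · refine hmul.congr_fun fun k => ?_
    have h := Nat.factorial_mul_descFactorial (Nat.le_add_left j k)
    rw [Nat.add_sub_cancel] at h
    have h' : ((k + j).factorial : ℝ) = k.factorial * (k + j).descFactorial j := by
      exact_mod_cast h.symm
    have hk : (k.factorial : ℝ) ≠ 0 := by positivity
    have hd : ((k + j).descFactorial j : ℝ) ≠ 0 := by
      intro h0
      rw [h0, mul_zero] at h'
      exact (Nat.cast_ne_zero.mpr (Nat.factorial_ne_zero _)) h'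
    rw [h', pow_add]
    field_simp
  · intro k hk
    rw [Nat.descFactorial_of_lt (Finset.mem_range.mp hk)]
    simp

theorem cast_descFactorial_three (k : ℕ) :
    (k.descFactorial 3 : ℝ) = k * (k - 1) * (k - 2) := by
  rw [← descPochhammer_eval_eq_descFactorial]
  simp [descPochhammer_succ_right]

theorem cast_descFactorial_four (k : ℕ) :
    (k.descFactorial 4 : ℝ) = k * (k - 1) * (k - 2) * (k - 3) := by
  rw [← descPochhammer_eval_eq_descFactorial]
  simp [descPochhammer_succ_right]

/-- The mass, first, second and fourth central moments of the Szász–Mirakyan weights. -/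
theorem szasz_moments (n : ℕ) (hn : 0 < n) (x : ℝ) :
    HasSum (fun k : ℕ => Real.exp (-((n : ℝ) * x)) * ((n : ℝ) * x) ^ k / k.factorial) 1 ∧
    HasSum (fun k : ℕ => Real.exp (-((n : ℝ) * x)) * ((n : ℝ) * x) ^ k / k.factorial *
      ((k : ℝ) / n - x)) 0 ∧
    HasSum (fun k : ℕ => Real.exp (-((n : ℝ) * x)) * ((n : ℝ) * x) ^ k / k.factorial *
      ((k : ℝ) / n - x) ^ 2) (x / n) ∧
    HasSum (fun k : ℕ => Real.exp (-((n : ℝ) * x)) * ((n : ℝ) * x) ^ k / k.factorial *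
      ((k : ℝ) / n - x) ^ 4) (3 * x ^ 2 / n ^ 2 + x / n ^ 3) := by
  have hn0 : (n : ℝ) ≠ 0 := by positivity
  have h0 := hasSum_poisson_descFactorial ((n : ℝ) * x) 0
  have h1 := hasSum_poisson_descFactorial ((n : ℝ) * x) 1
  have h2 := hasSum_poisson_descFactorial ((n : ℝ) * x) 2
  have h3 := hasSum_poisson_descFactorial ((n : ℝ) * x) 3
  have h4 := hasSum_poisson_descFactorial ((n : ℝ) * x) 4
  simp only [Nat.descFactorial_zero, Nat.descFactorial_one, Nat.cast_descFactorial_two,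
    cast_descFactorial_three, cast_descFactorial_four, Nat.cast_one, mul_one, pow_zero]
    at h0 h1 h2 h3 h4
  refine ⟨h0, ?_, ?_, ?_⟩
  · convert (h1.mul_left (1 / (n : ℝ))).add (h0.mul_left (-x)) using 1
    · rfl
    · funext k
      ring
    · field_simp
      ring
  · convert ((h2.mul_left (1 / (n : ℝ) ^ 2)).add
      (h1.mul_left (1 / (n : ℝ) ^ 2 - 2 * x / n))).add (h0.mul_left (x ^ 2)) using 1
    · rfl
    · funext k
      ring
    · field_simp
      ring
  · convert ((((h4.mul_left (1 / (n : ℝ) ^ 4)).add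
      (h3.mul_left (6 / (n : ℝ) ^ 4 - 4 * x / n ^ 3))).add
      (h2.mul_left (7 / (n : ℝ) ^ 4 - 12 * x / n ^ 3 + 6 * x ^ 2 / n ^ 2))).add
      (h1.mul_left (1 / (n : ℝ) ^ 4 - 4 * x / n ^ 3 + 6 * x ^ 2 / n ^ 2 - 4 * x ^ 3 / n))).add
      (h0.mul_left (x ^ 4)) using 1
    · rfl
    · funext k
      ring
    · field_simp
      ring

/-- Second-order Taylor estimate in terms of the oscillation of the second derivative. -/
theorem abs_taylor_two_remainder_le {f f₁ f₂ : ℝ → ℝ}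
    (h₁ : ∀ s ∈ Set.Ici (0 : ℝ), HasDerivWithinAt f (f₁ s) (Set.Ici 0) s)
    (h₂ : ∀ s ∈ Set.Ici (0 : ℝ), HasDerivWithinAt f₁ (f₂ s) (Set.Ici 0) s)
    {x t B : ℝ} (hx : 0 ≤ x) (ht : 0 ≤ t)
    (hB : ∀ s ∈ Set.uIcc x t, |f₂ s - f₂ x| ≤ B) :
    |f t - f x - f₁ x * (t - x) - f₂ x / 2 * (t - x) ^ 2| ≤ B * (t - x) ^ 2 := by
  have hsub : Set.uIcc x t ⊆ Set.Ici 0 := fun s hs => (le_min hx ht).trans hs.1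
  have hconv : Convex ℝ (Set.uIcc x t) := convex_uIcc x t
  have hB0 : 0 ≤ B := (abs_nonneg _).trans (hB x Set.left_mem_uIcc)
  have hd : ∀ s ∈ Set.uIcc x t, |f₁ s - f₁ x - f₂ x * (s - x)| ≤ B * |t - x| := by
    intro s hs
    have key := hconv.norm_image_sub_le_of_norm_hasDerivWithin_le
      (f := fun s => f₁ s - f₂ x * (s - x)) (f' := fun s => f₂ s - f₂ x * 1) (C := B)
      (fun u hu => ((h₂ u (hsub hu)).mono hsub).sub
        (((hasDerivWithinAt_id u _).sub_const x).const_mul (f₂ x)))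
      (fun u hu => by simpa using hB u hu) Set.left_mem_uIcc hs
    simp only [Real.norm_eq_abs, sub_self, mul_zero, sub_zero] at key
    calc |f₁ s - f₁ x - f₂ x * (s - x)| = |f₁ s - f₂ x * (s - x) - f₁ x| := by congr 1; ring
      _ ≤ B * |s - x| := key
      _ ≤ B * |t - x| := mul_le_mul_of_nonneg_left (Set.abs_sub_left_of_mem_uIcc hs) hB0
  have key := hconv.norm_image_sub_le_of_norm_hasDerivWithin_le
    (f := fun s => f s - f₁ x * (s - x) - f₂ x / 2 * (s - x) ^ 2)
    (f' := fun s => f₁ s - f₁ x * 1 - f₂ x / 2 * ((2 : ℕ) * (s - x) ^ (2 - 1) * 1))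
    (C := B * |t - x|)
    (fun u hu => (((h₁ u (hsub hu)).mono hsub).sub
      (((hasDerivWithinAt_id u _).sub_const x).const_mul (f₁ x))).sub
      ((((hasDerivWithinAt_id u _).sub_const x).pow 2).const_mul (f₂ x / 2)))
    (fun u hu => by
      rw [Real.norm_eq_abs]
      convert hd u hu using 2
      push_cast
      ring) Set.left_mem_uIcc Set.right_mem_uIcc
  simp only [Real.norm_eq_abs] at key
  calc |f t - f x - f₁ x * (t - x) - f₂ x / 2 * (t - x) ^ 2| = _ := by
        congr 1
        ring
    _ ≤ B * |t - x| * |t - x| := key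
    _ = B * (t - x) ^ 2 := by rw [mul_assoc, ← pow_two, sq_abs]

/-- A continuous function on `[0, ∞)` vanishing at infinity has an oscillation controlled by a
squared distance with a gain of one power of the base point. -/
theorem exists_abs_sub_le_of_tendsto_zero {g : ℝ → ℝ} (hg : ContinuousOn g (Set.Ici 0))
    (hg0 : Tendsto g atTop (nhds 0)) {ε : ℝ} (hε : 0 < ε) :
    ∃ C : ℝ, 0 ≤ C ∧ ∀ x ≥ (0 : ℝ), ∀ t ≥ (0 : ℝ), ∀ s ∈ Set.uIcc x t,
      |g s - g x| ≤ ε + C / (1 + x) * (t - x) ^ 2 := by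
  have hev : ∀ᶠ y in atTop, |g y| < ε / 2 := by
    simpa using (Metric.tendsto_nhds.mp hg0) (ε / 2) (half_pos hε)
  obtain ⟨R₀, hR₀⟩ := eventually_atTop.mp hev
  set R := max R₀ 0 with hRdef
  have hR0 : 0 ≤ R := le_max_right _ _
  have hR : ∀ y ≥ R, |g y| < ε / 2 := fun y hy => hR₀ y ((le_max_left _ _).trans hy)
  obtain ⟨M, hM⟩ := isCompact_Icc.exists_bound_of_continuousOn
    (hg.mono (Set.Icc_subset_Ici_self : Set.Icc 0 R ⊆ _))
  have huc := isCompact_Icc.uniformContinuousOn_of_continuous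
    (hg.mono (Set.Icc_subset_Ici_self : Set.Icc 0 (R + 1) ⊆ _))
  obtain ⟨δ₀, hδ₀, hδ⟩ := Metric.uniformContinuousOn_iff.mp huc ε hε
  set δ := min δ₀ 1 with hδdef
  have hδ0 : 0 < δ := lt_min hδ₀ one_pos
  set L := max M (ε / 2) with hLdef
  have hL0 : 0 ≤ L := (half_pos hε).le.trans (le_max_right _ _)
  have hL : ∀ y ≥ (0 : ℝ), |g y| ≤ L := by
    intro y hy
    rcases le_total y R with h | h
    · exact (hM y ⟨hy, h⟩).trans (le_max_left _ _)
    · exact (hR y h).le.trans (le_max_right _ _)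
  set K := (1 + R) / δ ^ 2 + 1 / δ with hK
  have hK0 : 0 ≤ K := by positivity
  refine ⟨2 * L * K, by positivity, fun x hx t ht s hs => ?_⟩
  have hs0 : 0 ≤ s := (le_min hx ht).trans hs.1
  have hst : |s - x| ≤ |t - x| := Set.abs_sub_left_of_mem_uIcc hs
  have hpos : 0 ≤ 2 * L * K / (1 + x) * (t - x) ^ 2 := by positivity
  by_cases hfar : R ≤ x ∧ R ≤ s
  · have h1 := hR x hfar.1
    have h2 := hR s hfar.2
    have := abs_sub (g s) (g x)
    linarith
  have hxR : x ≤ R + |t - x| := by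
    rcases not_and_or.mp hfar with h | h
    · linarith [abs_nonneg (t - x)]
    · linarith [neg_abs_le (s - x)]
  have hsR : s ≤ R + |t - x| := by
    rcases not_and_or.mp hfar with h | h
    · linarith [le_abs_self (s - x)]
    · linarith [abs_nonneg (t - x)]
  rcases lt_or_ge |t - x| δ with hd | hd
  · have hδ1 : δ ≤ 1 := min_le_right _ _
    have := hδ s ⟨hs0, by linarith⟩ x ⟨hx, by linarith⟩ (by
      rw [Real.dist_eq]
      exact (hst.trans_lt hd).trans_le (min_le_left _ _))
    rw [Real.dist_eq] at this
    linarith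
  · have hK1 : 1 + x ≤ K * (t - x) ^ 2 := by
      rw [← sq_abs (t - x)]
      set d := |t - x|
      have hr : 1 ≤ d / δ := (one_le_div hδ0).mpr hd
      have hd0 : 0 ≤ d := abs_nonneg _
      have e : K * d ^ 2 = (1 + R) * (d / δ) ^ 2 + d * (d / δ) := by
        rw [hK]
        field_simp
      rw [e]
      have h1 : 1 + R ≤ (1 + R) * (d / δ) ^ 2 :=
        le_mul_of_one_le_right (by linarith) (one_le_pow₀ hr)
      have h2 : d ≤ d * (d / δ) := le_mul_of_one_le_right hd0 hr
      linarith
    have h1 := hL x hx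
    have h2 := hL s hs0
    have h3 := abs_sub (g s) (g x)
    have h4 : 1 ≤ K * (t - x) ^ 2 / (1 + x) := (one_le_div (by linarith)).mpr hK1
    have h5 : 2 * L ≤ 2 * L * K / (1 + x) * (t - x) ^ 2 := by
      calc 2 * L ≤ 2 * L * (K * (t - x) ^ 2 / (1 + x)) :=
            le_mul_of_one_le_right (by linarith) h4
        _ = _ := by ring
    linarith

/-- Quantitative Voronovskaya estimate for functions with a second-order Taylor expansion. -/
theorem abs_szasz_sub_le {f : ℝ → ℝ} {n : ℕ} (hn : 0 < n) {x a b ε C : ℝ} (hx : 0 ≤ x)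
    (hC : 0 ≤ C)
    (hr : ∀ t ≥ (0 : ℝ), |f t - f x - a * (t - x) - b / 2 * (t - x) ^ 2| ≤
      (ε + C / (1 + x) * (t - x) ^ 2) * (t - x) ^ 2) :
    |(n : ℝ) * (szasz n f x - f x) - x / 2 * b| ≤ (ε + 4 * C / n) * x := by
  obtain ⟨m0, m1, m2, m4⟩ := szasz_moments n hn x
  have hn1 : (1 : ℝ) ≤ n := by exact_mod_cast hn
  have hn0 : (0 : ℝ) < n := by positivity
  set p : ℕ → ℝ := fun k => Real.exp (-((n : ℝ) * x)) * ((n : ℝ) * x) ^ k / k.factorial with hp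
  have hp0 : ∀ k, 0 ≤ p k := fun k => by positivity
  set r : ℝ → ℝ := fun t => f t - f x - a * (t - x) - b / 2 * (t - x) ^ 2 with hrdef
  have hbd := (m2.mul_left ε).add (m4.mul_left (C / (1 + x)))
  have hle : ∀ k : ℕ, ‖p k * r (k / n)‖ ≤ ε * (p k * ((k : ℝ) / n - x) ^ 2) +
      C / (1 + x) * (p k * ((k : ℝ) / n - x) ^ 4) := by
    intro k
    rw [Real.norm_eq_abs, abs_mul, abs_of_nonneg (hp0 k)]
    calc p k * |r (k / n)| ≤ p k * _ :=
          mul_le_mul_of_nonneg_left (hr (k / n) (by positivity)) (hp0 k)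
      _ = _ := by ring
  have hsum : Summable fun k : ℕ => p k * r (k / n) := Summable.of_norm_bounded hbd.summable hle
  have hnorm : |∑' k : ℕ, p k * r (k / n)| ≤ _ := tsum_of_norm_bounded hbd hle
  have hS : szasz n f x = ∑' k : ℕ, p k * r (k / n) + (f x * 1 + a * 0 + b / 2 * (x / n)) := by
    refine HasSum.tsum_eq ?_
    convert hsum.hasSum.add (((m0.mul_left (f x)).add (m1.mul_left a)).add
      (m2.mul_left (b / 2))) using 1
    funext k
    simp only [hp, hrdef]
    ring
  have e : (n : ℝ) * (szasz n f x - f x) - x / 2 * b = n * ∑' k : ℕ, p k * r (k / n) := by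
    rw [hS]
    field_simp
    ring
  rw [e, abs_mul, abs_of_pos hn0]
  refine (mul_le_mul_of_nonneg_left hnorm hn0.le).trans ?_
  have e2 : (n : ℝ) * (ε * (x / n) + C / (1 + x) * (3 * x ^ 2 / n ^ 2 + x / n ^ 3)) =
      ε * x + C / n * x * ((3 * x + 1 / n) / (1 + x)) := by
    field_simp
  have h1 : (3 * x + 1 / n) / (1 + x) ≤ 4 := by
    rw [div_le_iff₀ (by linarith)]
    have : 1 / (n : ℝ) ≤ 1 := (div_le_one hn0).mpr hn1
    linarith
  rw [e2]
  have h2 : C / n * x * ((3 * x + 1 / n) / (1 + x)) ≤ C / n * x * 4 :=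
    mul_le_mul_of_nonneg_left h1 (by positivity)
  calc _ ≤ ε * x + C / n * x * 4 := by linarith
    _ = _ := by ring

theorem wt_nonneg (α : ℝ) {x : ℝ} (hx : 0 ≤ x) : 0 ≤ wt α x := by
  unfold wt
  positivity

theorem wt_mul_self_le_one {α x : ℝ} (hα : 1 ≤ α) (hx : 0 ≤ x) : wt α x * x ≤ 1 := by
  have hpow : 0 ≤ x ^ α := Real.rpow_nonneg hx α
  rw [wt, one_div_mul_eq_div, div_le_one (by linarith)]
  rcases le_total x 1 with h | h
  · linarith
  · have := Real.rpow_le_rpow_of_exponent_le h hα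
    rw [Real.rpow_one] at this
    linarith

/-- **Voronovskaya-type theorem for the Szász–Mirakyan operator.**
Let `α ≥ 1` and let `f : [0,∞) → ℝ` be twice continuously differentiable such that both `f`
and `f''` vanish at infinity. Then
`lim_{n→∞} sup_{x ≥ 0} w_α(x) · |n (𝒫ₙ f (x) − f(x)) − 𝒜 f (x)| = 0`. -/
theorem szasz_voronovskaya (α : ℝ) (hα : 1 ≤ α) (f : ℝ → ℝ)
    (hf : ContDiffOn ℝ 2 f (Set.Ici 0))
    (hf0 : Tendsto f atTop (nhds 0))
    (hf2 : Tendsto (iteratedDerivWithin 2 f (Set.Ici 0)) atTop (nhds 0)) :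
    ∀ ε > (0 : ℝ), ∃ N : ℕ, ∀ n ≥ N, ∀ x ≥ (0 : ℝ),
      wt α x * |(n : ℝ) * (szasz n f x - f x) - opA f x| < ε := by
  intro ε hε
  have hu : UniqueDiffOn ℝ (Set.Ici (0 : ℝ)) := uniqueDiffOn_Ici 0
  have hcont := hf.continuousOn_iteratedDerivWithin le_rfl hu
  have h₁ : ∀ s ∈ Set.Ici (0 : ℝ),
      HasDerivWithinAt f (derivWithin f (Set.Ici 0) s) (Set.Ici 0) s := fun s hs =>
    (hf.differentiableOn (by norm_num) s hs).hasDerivWithinAt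
  have h₂ : ∀ s ∈ Set.Ici (0 : ℝ), HasDerivWithinAt (derivWithin f (Set.Ici 0))
      (iteratedDerivWithin 2 f (Set.Ici 0) s) (Set.Ici 0) s := by
    intro s hs
    have hd := hf.differentiableOn_iteratedDerivWithin (m := 1) (by norm_num) hu
    rw [iteratedDerivWithin_one] at hd
    rw [iteratedDerivWithin_succ, iteratedDerivWithin_one]
    exact (hd s hs).hasDerivWithinAt
  obtain ⟨C, hC, hosc⟩ := exists_abs_sub_le_of_tendsto_zero hcont hf2 (half_pos hε)
  obtain ⟨N, hN⟩ := exists_nat_gt (8 * C / ε)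
  refine ⟨max N 1, fun n hn x hx => ?_⟩
  have hn1 : 0 < n := (le_max_right N 1).trans hn
  have hnN : (N : ℝ) ≤ n := by exact_mod_cast (le_max_left N 1).trans hn
  have hn0 : (0 : ℝ) < n := by exact_mod_cast hn1
  have hsmall : 4 * C / n < ε / 2 := by
    have := (div_lt_iff₀ hε).mp (hN.trans_le hnN)
    rw [div_lt_iff₀ hn0]
    linarith
  have hest := abs_szasz_sub_le hn1 hx hC fun t ht =>
    abs_taylor_two_remainder_le h₁ h₂ hx ht (hosc x hx t ht)
  calc wt α x * |(n : ℝ) * (szasz n f x - f x) - opA f x|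
      ≤ wt α x * ((ε / 2 + 4 * C / n) * x) := mul_le_mul_of_nonneg_left hest (wt_nonneg α hx)
    _ = (ε / 2 + 4 * C / n) * (wt α x * x) := by ring
    _ ≤ ε / 2 + 4 * C / n :=
      mul_le_of_le_one_right (by positivity) (wt_mul_self_le_one hα hx)
    _ < ε := by linarith
end

section
/- Let α > 3/2 and let f : [0,∞) → ℝ be twice continuously differentiable such that f and f'' vanish at infinity and f'' is Lipschitz continuous. Then for every integer n ≥ 1, sup_{x∈[0,∞)} w_α(x) · |n(𝒫ₙf(x) − f(x)) − 𝒜f(x)| ≤ (1/(6√n)) · M_α · Lip(f''), where M_α = 3^{3/4}·((2α−3)/(2α))·(3/(2α−3))^{3/(2α)} + ((4α−3)/(4α))·(3/(4α−3))^{3/(4α)}. -/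
open Filter

/-- The constant
`M_α = 3^{3/4}·((2α−3)/(2α))·(3/(2α−3))^{3/(2α)} + ((4α−3)/(4α))·(3/(4α−3))^{3/(4α)}`. -/
noncomputable def Mconst (α : ℝ) : ℝ :=
  (3 : ℝ) ^ ((3 : ℝ) / 4) * ((2 * α - 3) / (2 * α)) * (3 / (2 * α - 3)) ^ (3 / (2 * α))
    + ((4 * α - 3) / (4 * α)) * (3 / (4 * α - 3)) ^ (3 / (4 * α))

/-- Antidifferentiating a power bound around a base point of `[0, ∞)`. -/
lemma abs_le_of_abs_derivWithin_le_pow {G g : ℝ → ℝ} {x C : ℝ} (p : ℕ) (hx : 0 ≤ x)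
    (hG : ∀ t, 0 ≤ t → HasDerivWithinAt G (g t) (Set.Ici 0) t) (hGx : G x = 0)
    (hg : ∀ t, 0 ≤ t → |g t| ≤ C * |t - x| ^ p) {y : ℝ} (hy : 0 ≤ y) :
    |G y| ≤ C / (p + 1) * |y - x| ^ (p + 1) := by
  have hmem : ∀ s ∈ Set.Icc (0 : ℝ) 1, 0 ≤ x + s * (y - x) := by
    intro s hs
    nlinarith [mul_nonneg hs.1 hy, mul_nonneg (sub_nonneg.2 hs.2) hx]
  have hline : ∀ s, HasDerivAt (fun s : ℝ => x + s * (y - x)) (y - x) s := by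
    intro s
    simpa using ((hasDerivAt_id s).mul_const (y - x)).const_add x
  have hφ : ∀ s ∈ Set.Icc (0 : ℝ) 1, HasDerivWithinAt (fun s => G (x + s * (y - x)))
      (g (x + s * (y - x)) * (y - x)) (Set.Icc 0 1) s := by
    intro s hs
    exact (hG _ (hmem s hs)).comp s (hline s).hasDerivWithinAt (fun u hu => hmem u hu)
  have hB : ∀ s : ℝ, HasDerivAt
      (fun s : ℝ => C / (p + 1) * |y - x| ^ (p + 1) * s ^ (p + 1))
      (C * |y - x| ^ (p + 1) * s ^ p) s := by
    intro s
    have h := (hasDerivAt_pow (p + 1) s).const_mul (C / (p + 1) * |y - x| ^ (p + 1))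
    refine h.congr_deriv ?_
    have : (p : ℝ) + 1 ≠ 0 := by positivity
    push_cast
    field_simp
  have key := image_norm_le_of_norm_deriv_right_le_deriv_boundary
    (f := fun s => G (x + s * (y - x))) (f' := fun s => g (x + s * (y - x)) * (y - x))
    (a := 0) (b := 1) (fun s hs => (hφ s hs).continuousWithinAt)
    (fun s hs => ((hφ s (Set.Ico_subset_Icc_self hs)).mono_of_mem_nhdsWithin
      (Icc_mem_nhdsGE_of_mem hs)))
    (B := fun s : ℝ => C / (p + 1) * |y - x| ^ (p + 1) * s ^ (p + 1)) (by simp [hGx]) hB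
    (fun s hs => by
      have h := hg _ (hmem s (Set.Ico_subset_Icc_self hs))
      rw [add_sub_cancel_left, abs_mul, abs_of_nonneg hs.1, mul_pow] at h
      rw [Real.norm_eq_abs, abs_mul]
      calc _ ≤ (C * (s ^ p * |y - x| ^ p)) * |y - x| :=
            mul_le_mul_of_nonneg_right h (abs_nonneg _)
        _ = _ := by ring)
    (Set.right_mem_Icc.2 zero_le_one)
  simpa using key

/-- Second order Taylor estimate on `[0, ∞)` for a function with Lipschitz second derivative. -/
lemma abs_taylor_remainder_le_of_lipschitzOnWith {f : ℝ → ℝ} {K : NNReal}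
    (hf : ContDiffOn ℝ 2 f (Set.Ici 0))
    (hK : LipschitzOnWith K (iteratedDerivWithin 2 f (Set.Ici 0)) (Set.Ici 0))
    {x y : ℝ} (hx : 0 ≤ x) (hy : 0 ≤ y) :
    |f y - (f x + derivWithin f (Set.Ici 0) x * (y - x)
      + iteratedDerivWithin 2 f (Set.Ici 0) x / 2 * (y - x) ^ 2)| ≤ K / 6 * |y - x| ^ 3 := by
  set f' := derivWithin f (Set.Ici 0) with hf'
  set f'' := iteratedDerivWithin 2 f (Set.Ici 0) with hf''
  have hd1 : ∀ t, 0 ≤ t → HasDerivWithinAt f (f' t) (Set.Ici 0) t := fun t ht =>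
    (hf.differentiableOn (by norm_num) t ht).hasDerivWithinAt
  have hd2 : ∀ t, 0 ≤ t → HasDerivWithinAt f' (f'' t) (Set.Ici 0) t := by
    intro t ht
    have h := (hf.differentiableOn_iteratedDerivWithin (m := 1) (by norm_num)
      (uniqueDiffOn_Ici 0) t ht).hasDerivWithinAt
    rw [← iteratedDerivWithin_succ] at h
    exact h.congr_of_mem (fun u _ => by rw [iteratedDerivWithin_one]) ht
  have hlin : ∀ t, HasDerivWithinAt (fun t : ℝ => t - x) 1 (Set.Ici 0) t := fun t =>
    (hasDerivWithinAt_id t _).sub_const x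
  have h1 : ∀ t, 0 ≤ t → |f' t - (f' x + f'' x * (t - x))| ≤ K / 2 * |t - x| ^ 2 := by
    intro t ht
    have := abs_le_of_abs_derivWithin_le_pow (G := fun t => f' t - (f' x + f'' x * (t - x)))
      (g := fun t => f'' t - f'' x) (x := x) (C := K) 1 hx
      (fun t ht => by
        refine ((hd2 t ht).sub (((hlin t).const_mul (f'' x)).const_add (f' x))).congr_deriv ?_
        ring)
      (by simp)
      (fun t ht => by simpa [Real.dist_eq] using hK.dist_le_mul t ht x hx) ht
    norm_num at this ⊢
    exact this
  have := abs_le_of_abs_derivWithin_le_pow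
    (G := fun t => f t - (f x + f' x * (t - x) + f'' x / 2 * (t - x) ^ 2))
    (g := fun t => f' t - (f' x + f'' x * (t - x))) (x := x) (C := K / 2) 2 hx
    (fun t ht => by
      refine ((hd1 t ht).sub ((((hlin t).const_mul (f' x)).const_add (f x)).add
        (((hlin t).pow 2).const_mul (f'' x / 2)))).congr_deriv ?_
      simp
      ring)
    (by simp) h1 hy
  refine this.trans_eq ?_
  push_cast
  ring

lemma cast_descFactorial_succ_eq (k j : ℕ) :
    (k.descFactorial (j + 1) : ℝ) = (k - j) * k.descFactorial j := by
  rw [Nat.descFactorial_succ, Nat.cast_mul]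
  rcases le_or_gt j k with h | h
  · rw [Nat.cast_sub h]
  · simp [Nat.descFactorial_eq_zero_iff_lt.2 h]

lemma HasSum.congr_fun_of_eq {u v : ℕ → ℝ} {a b : ℝ} (h : HasSum u a)
    (huv : ∀ k, v k = u k) (hab : b = a) : HasSum v b :=
  hab ▸ h.congr_fun huv

/-- Factorial moments of the Poisson distribution. -/
lemma hasSum_poisson_mul_descFactorial (l : ℝ) (j : ℕ) :
    HasSum (fun k : ℕ => Real.exp (-l) * l ^ k / (Nat.factorial k) * (k.descFactorial j : ℝ))
      (l ^ j) := by
  rw [← hasSum_nat_add_iff' j, Finset.sum_eq_zero, sub_zero]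
  · have h : HasSum (fun k : ℕ => l ^ k / (Nat.factorial k)) (Real.exp l) := by
      rw [Real.exp_eq_exp_ℝ]
      exact NormedSpace.expSeries_div_hasSum_exp l
    have h2 := h.mul_left (Real.exp (-l) * l ^ j)
    have e : Real.exp (-l) * l ^ j * Real.exp l = l ^ j := by
      rw [mul_right_comm, ← Real.exp_add]; simp
    rw [e] at h2
    refine h2.congr_fun ?_
    intro k
    have hk := Nat.factorial_mul_descFactorial (Nat.le_add_left j k)
    rw [Nat.add_sub_cancel] at hk
    have hk' : ((Nat.factorial (k + j) : ℕ) : ℝ)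
        = (Nat.factorial k : ℝ) * ((k + j).descFactorial j : ℝ) := by
      exact_mod_cast hk.symm
    have h0 : ((k + j).descFactorial j : ℝ) ≠ 0 := by
      intro h
      rw [h, mul_zero] at hk'
      exact (Nat.cast_ne_zero.2 (Nat.factorial_ne_zero _)) hk'
    rw [hk', pow_add]
    field_simp
  · intro i hi
    simp [Nat.descFactorial_eq_zero_iff_lt.2 (Finset.mem_range.1 hi)]

lemma hasSum_poisson (l : ℝ) :
    HasSum (fun k : ℕ => Real.exp (-l) * l ^ k / (Nat.factorial k)) 1 := by
  simpa using hasSum_poisson_mul_descFactorial l 0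

lemma hasSum_poisson_mul_sub (l : ℝ) :
    HasSum (fun k : ℕ => Real.exp (-l) * l ^ k / (Nat.factorial k) * ((k : ℝ) - l)) 0 := by
  have h := (hasSum_poisson_mul_descFactorial l 1).sub ((hasSum_poisson l).mul_right l)
  refine h.congr_fun_of_eq (fun k => ?_) ?_
  · simp; ring
  · ring

lemma hasSum_poisson_mul_sub_sq (l : ℝ) :
    HasSum (fun k : ℕ => Real.exp (-l) * l ^ k / (Nat.factorial k) * ((k : ℝ) - l) ^ 2) l := by
  have h := (((hasSum_poisson_mul_descFactorial l 2).add
    ((hasSum_poisson_mul_descFactorial l 1).mul_right (1 - 2 * l))).add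
    ((hasSum_poisson l).mul_right (l ^ 2)))
  refine h.congr_fun_of_eq (fun k => ?_) ?_
  · simp only [cast_descFactorial_succ_eq, Nat.descFactorial_zero]; push_cast; ring
  · ring

lemma hasSum_poisson_mul_sub_pow_four (l : ℝ) :
    HasSum (fun k : ℕ => Real.exp (-l) * l ^ k / (Nat.factorial k) * ((k : ℝ) - l) ^ 4)
      (3 * l ^ 2 + l) := by
  have h := (((((hasSum_poisson_mul_descFactorial l 4).add
    ((hasSum_poisson_mul_descFactorial l 3).mul_right (6 - 4 * l))).add
    ((hasSum_poisson_mul_descFactorial l 2).mul_right (7 - 12 * l + 6 * l ^ 2))).add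
    ((hasSum_poisson_mul_descFactorial l 1).mul_right
      (1 - 4 * l + 6 * l ^ 2 - 4 * l ^ 3))).add
    ((hasSum_poisson l).mul_right (l ^ 4)))
  refine h.congr_fun_of_eq (fun k => ?_) ?_
  · simp only [cast_descFactorial_succ_eq, Nat.descFactorial_zero]; push_cast; ring
  · ring

/-- Sharp comparison of `x ^ β` with `1 + x ^ α`, from weighted AM-GM. -/
lemma wt_mul_rpow_le {α β x : ℝ} (hβ : 0 < β) (hα : β < α) (hx : 0 ≤ x) :
    wt α x * x ^ β ≤ (α - β) / α * (β / (α - β)) ^ (β / α) := by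
  have hα0 : 0 < α := hβ.trans hα
  have hd : 0 < α - β := sub_pos.2 hα
  have hθ : 0 < β / α := by positivity
  have hθ' : 0 < (α - β) / α := by positivity
  have hsum : β / α + (α - β) / α = 1 := by field_simp; ring
  have hu : 0 ≤ x ^ α := Real.rpow_nonneg hx α
  have h := Real.geom_mean_le_arith_mean2_weighted hθ.le hθ'.le
    (div_nonneg hu hθ.le) (one_div_pos.2 hθ').le hsum
  rw [mul_div_cancel₀ _ hθ.ne', mul_one_div_cancel hθ'.ne', Real.div_rpow hu hθ.le,
    ← Real.rpow_mul hx, mul_div_cancel₀ _ hα0.ne'] at h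
  have e : (α - β) / α * (β / (α - β)) ^ (β / α)
      = (β / α) ^ (β / α) / (1 / ((α - β) / α)) ^ ((α - β) / α) := by
    have h1 : β / (α - β) = (β / α) / ((α - β) / α) := by field_simp
    have h2 : (α - β) / α = 1 - β / α := by field_simp
    rw [h1, Real.div_rpow hθ.le hθ'.le, one_div, Real.inv_rpow hθ'.le, div_inv_eq_mul]
    have h3 : ((α - β) / α) ^ (β / α) * ((α - β) / α) ^ ((α - β) / α) = (α - β) / α := by
      rw [← Real.rpow_add hθ', hsum, Real.rpow_one]
    have h4 : ((α - β) / α) ^ (β / α) ≠ 0 := (Real.rpow_pos_of_pos hθ' _).ne'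
    field_simp at h3 ⊢
    linear_combination (-1 : ℝ) * h3
  have hA : 0 < (β / α) ^ (β / α) := Real.rpow_pos_of_pos hθ _
  have hB : 0 < (1 / ((α - β) / α)) ^ ((α - β) / α) :=
    Real.rpow_pos_of_pos (one_div_pos.2 hθ') _
  rw [e, wt, one_div_mul_eq_div, div_le_div_iff₀ (by linarith) hB]
  rw [div_mul_eq_mul_div, div_le_iff₀ hA] at h
  linarith

/-- Weighted bound of the fourth-moment term against `Mconst`. -/
lemma wt_mul_rpow_three_quarters_le {α x : ℝ} (hα : 3 / 2 < α) (hx : 0 ≤ x) :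
    wt α x * (3 * x ^ 2 + x) ^ ((3 : ℝ) / 4) ≤ Mconst α := by
  have hw : 0 ≤ wt α x := by
    have := Real.rpow_nonneg hx α
    unfold wt; positivity
  have h1 := wt_mul_rpow_le (α := α) (β := 3 / 2) (by norm_num) hα hx
  have h2 := wt_mul_rpow_le (α := α) (β := 3 / 4) (by norm_num) (by linarith) hx
  have e1 : (α - 3 / 2) / α * (3 / 2 / (α - 3 / 2)) ^ (3 / 2 / α)
      = (2 * α - 3) / (2 * α) * (3 / (2 * α - 3)) ^ (3 / (2 * α)) := by
    congr 1
    · field_simp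
    · congr 1
      · rw [div_div]; congr 1; ring
      · rw [div_div]
  have e2 : (α - 3 / 4) / α * (3 / 4 / (α - 3 / 4)) ^ (3 / 4 / α)
      = (4 * α - 3) / (4 * α) * (3 / (4 * α - 3)) ^ (3 / (4 * α)) := by
    congr 1
    · field_simp
    · congr 1
      · rw [div_div]; congr 1; ring
      · rw [div_div]
  rw [e1] at h1
  rw [e2] at h2
  have h3 : (3 * x ^ 2 + x) ^ ((3 : ℝ) / 4)
      ≤ (3 : ℝ) ^ ((3 : ℝ) / 4) * x ^ ((3 : ℝ) / 2) + x ^ ((3 : ℝ) / 4) := by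
    refine (Real.rpow_add_le_add_rpow (by positivity) hx (by norm_num) (by norm_num)).trans_eq ?_
    rw [Real.mul_rpow (by norm_num) (by positivity), ← Real.rpow_natCast x 2,
      ← Real.rpow_mul hx]
    norm_num
  have h4 : (0 : ℝ) ≤ (3 : ℝ) ^ ((3 : ℝ) / 4) := by positivity
  calc _ ≤ wt α x * ((3 : ℝ) ^ ((3 : ℝ) / 4) * x ^ ((3 : ℝ) / 2) + x ^ ((3 : ℝ) / 4)) :=
        mul_le_mul_of_nonneg_left h3 hw
    _ = (3 : ℝ) ^ ((3 : ℝ) / 4) * (wt α x * x ^ ((3 : ℝ) / 2)) + wt α x * x ^ ((3 : ℝ) / 4) := by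
        ring
    _ ≤ _ := by
        rw [Mconst, mul_assoc]
        exact add_le_add (mul_le_mul_of_nonneg_left h1 h4) h2

lemma szasz_zero (n : ℕ) (f : ℝ → ℝ) : szasz n f 0 = f 0 := by
  rw [szasz, tsum_eq_single 0 (fun k hk => by simp [hk])]
  simp

/-- Unweighted Voronovskaya-type estimate in terms of the fourth central moment. -/
lemma abs_szasz_voronovskaya_le {f : ℝ → ℝ} {K : NNReal}
    (hf : ContDiffOn ℝ 2 f (Set.Ici 0))
    (hK : LipschitzOnWith K (iteratedDerivWithin 2 f (Set.Ici 0)) (Set.Ici 0))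
    {n : ℕ} (hn : 1 ≤ n) {x : ℝ} (hx : 0 ≤ x) :
    |(n : ℝ) * (szasz n f x - f x) - opA f x|
      ≤ 1 / (6 * Real.sqrt n) * (3 * x ^ 2 + x) ^ ((3 : ℝ) / 4) * K := by
  rcases hx.eq_or_lt with rfl | hx0
  · rw [szasz_zero, opA]
    simp
  have hn1 : (1 : ℝ) ≤ n := by exact_mod_cast hn
  have hn0 : (0 : ℝ) < n := by linarith
  set a := derivWithin f (Set.Ici 0) x
  set b := iteratedDerivWithin 2 f (Set.Ici 0) x with hb
  set p : ℕ → ℝ := fun k => Real.exp (-((n : ℝ) * x)) * ((n : ℝ) * x) ^ k / (Nat.factorial k)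
    with hp
  have hp0 : ∀ k, 0 ≤ p k := fun k => by positivity
  set R : ℕ → ℝ := fun k => f (k / n) - (f x + a * (k / n - x) + b / 2 * (k / n - x) ^ 2) with hR
  have hRb : ∀ k, |R k| ≤ K / 6 * |(k : ℝ) / n - x| ^ 3 := fun k =>
    abs_taylor_remainder_le_of_lipschitzOnWith hf hK hx (by positivity)
  have hsub : ∀ k : ℕ, (k : ℝ) / n - x = (k - n * x) / n := fun k => by field_simp
  set q : ℝ := (3 * x ^ 2 + x) ^ ((1 : ℝ) / 4) with hq
  have hq0 : 0 < q := by positivity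
  have hq4 : q ^ 4 = 3 * x ^ 2 + x := by
    rw [hq, ← Real.rpow_natCast, ← Real.rpow_mul (by positivity)]
    norm_num
  have hq3 : q ^ 3 = (3 * x ^ 2 + x) ^ ((3 : ℝ) / 4) := by
    rw [hq, ← Real.rpow_natCast, ← Real.rpow_mul (by positivity)]
    norm_num
  set s := Real.sqrt n with hs
  have hs0 : 0 < s := Real.sqrt_pos.2 hn0
  have hs2 : s ^ 2 = n := Real.sq_sqrt hn0.le
  set c := q / s with hc
  have hc0 : 0 < c := by positivity
  have hm4 : HasSum (fun k : ℕ => p k * ((k : ℝ) / n - x) ^ 4)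
      ((3 * (n * x) ^ 2 + n * x) / n ^ 4) := by
    refine ((hasSum_poisson_mul_sub_pow_four (n * x)).div_const ((n : ℝ) ^ 4)).congr_fun
      fun k => ?_
    rw [hsub]; ring
  have hm4c : (3 * (n * x) ^ 2 + n * x) / (n : ℝ) ^ 4 ≤ c ^ 4 := by
    rw [hc, div_pow, hq4, show s ^ 4 = (s ^ 2) ^ 2 by ring, hs2, div_le_div_iff₀ (by positivity)
      (by positivity)]
    have : (n : ℝ) ^ 3 * x ≤ n ^ 4 * x :=
      mul_le_mul_of_nonneg_right (pow_le_pow_right₀ hn1 (by norm_num)) hx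
    nlinarith
  have hbound := ((hm4.mul_left (3 / (4 * c))).add
    ((hasSum_poisson (n * x)).mul_right (c ^ 3 / 4))).mul_left ((K : ℝ) / 6)
  have hterm : ∀ k, ‖p k * R k‖ ≤ (K : ℝ) / 6 *
      (3 / (4 * c) * (p k * ((k : ℝ) / n - x) ^ 4) + p k * (c ^ 3 / 4)) := by
    intro k
    rw [Real.norm_eq_abs, abs_mul, abs_of_nonneg (hp0 k)]
    have young : |(k : ℝ) / n - x| ^ 3
        ≤ 3 / (4 * c) * ((k : ℝ) / n - x) ^ 4 + c ^ 3 / 4 := by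
      rw [← (show Even 4 by decide).pow_abs ((k : ℝ) / n - x)]
      set t := |(k : ℝ) / n - x|
      have : 3 / (4 * c) * t ^ 4 + c ^ 3 / 4 - t ^ 3
          = (t - c) ^ 2 * (3 * t ^ 2 + 2 * t * c + c ^ 2) / (4 * c) := by
        field_simp; ring
      have h2 : 0 ≤ (t - c) ^ 2 * (3 * t ^ 2 + 2 * t * c + c ^ 2) / (4 * c) := by positivity
      linarith
    calc p k * |R k| ≤ p k * (K / 6 * (3 / (4 * c) * ((k : ℝ) / n - x) ^ 4 + c ^ 3 / 4)) := by
          refine mul_le_mul_of_nonneg_left ((hRb k).trans ?_) (hp0 k)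
          exact mul_le_mul_of_nonneg_left young (by positivity)
      _ = _ := by ring
  have hsR : Summable fun k => p k * R k := Summable.of_norm_bounded hbound.summable hterm
  have hRle : |∑' k, p k * R k| ≤ K / 6 * c ^ 3 := by
    refine (tsum_of_norm_bounded hbound hterm).trans ?_
    refine mul_le_mul_of_nonneg_left ?_ (by positivity)
    calc _ ≤ 3 / (4 * c) * c ^ 4 + 1 * (c ^ 3 / 4) := by gcongr
      _ = c ^ 3 := by field_simp; ring
  have hT : HasSum (fun k : ℕ => p k * f (k / n)) (f x + b / 2 * (x / n) + ∑' k, p k * R k) := by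
    have h := ((((hasSum_poisson (n * x)).mul_right (f x)).add
      ((hasSum_poisson_mul_sub (n * x)).mul_right (a / n))).add
      ((hasSum_poisson_mul_sub_sq (n * x)).mul_right (b / 2 / n ^ 2))).add hsR.hasSum
    refine h.congr_fun_of_eq (fun k => ?_) ?_
    · simp only [hR, hsub, hp]; field_simp; ring
    · field_simp; ring
  have hsz : szasz n f x = f x + b / 2 * (x / n) + ∑' k, p k * R k := hT.tsum_eq
  have he : (n : ℝ) * (szasz n f x - f x) - opA f x = n * ∑' k, p k * R k := by
    rw [hsz, opA, ← hb]; field_simp; ring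
  rw [he, abs_mul, abs_of_pos hn0, ← hq3]
  refine (mul_le_mul_of_nonneg_left hRle hn0.le).trans_eq ?_
  rw [hc, ← hs2]
  field_simp

/-- **Quantitative Voronovskaya-type theorem.**  Let `α > 3/2` and let `f : [0,∞) → ℝ` be twice
continuously differentiable such that `f` and `f''` vanish at infinity and `f''` is Lipschitz
(with constant `K`).  Then for every integer `n ≥ 1`,
`sup_{x ≥ 0} w_α(x) · |n (𝒫ₙ f (x) − f(x)) − 𝒜 f (x)| ≤ (1/(6√n)) · M_α · K`. -/
theorem szasz_voronovskaya_rate (α : ℝ) (hα : 3 / 2 < α) (f : ℝ → ℝ) (K : NNReal)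
    (hf : ContDiffOn ℝ 2 f (Set.Ici 0))
    (hf0 : Tendsto f atTop (nhds 0))
    (hf2 : Tendsto (iteratedDerivWithin 2 f (Set.Ici 0)) atTop (nhds 0))
    (hK : LipschitzOnWith K (iteratedDerivWithin 2 f (Set.Ici 0)) (Set.Ici 0))
    (n : ℕ) (hn : 1 ≤ n) :
    ∀ x ≥ (0 : ℝ), wt α x * |(n : ℝ) * (szasz n f x - f x) - opA f x|
      ≤ 1 / (6 * Real.sqrt n) * Mconst α * K := by
  intro x hx
  have hw : 0 ≤ wt α x := by
    have := Real.rpow_nonneg hx α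
    unfold wt
    positivity
  calc wt α x * |(n : ℝ) * (szasz n f x - f x) - opA f x|
      ≤ wt α x * (1 / (6 * Real.sqrt n) * (3 * x ^ 2 + x) ^ ((3 : ℝ) / 4) * K) :=
        mul_le_mul_of_nonneg_left (abs_szasz_voronovskaya_le hf hK hn hx) hw
    _ = 1 / (6 * Real.sqrt n) * (wt α x * (3 * x ^ 2 + x) ^ ((3 : ℝ) / 4)) * K := by ring
    _ ≤ 1 / (6 * Real.sqrt n) * Mconst α * K := by
        gcongr
        exact wt_mul_rpow_three_quarters_le hα hx
end

section
/- If f : [0,∞) → ℝ is continuous and vanishes at infinity, then for every integer n ≥ 1 the function 𝒫ₙf is continuous and vanishes at infinity, and ‖𝒫ₙf‖_∞ ≤ ‖f‖_∞. -/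
open Filter

/-- The sup-norm `‖f‖_∞ = sup_{x ≥ 0} |f(x)|`. -/
noncomputable def supnorm (f : ℝ → ℝ) : ℝ := ⨆ x : Set.Ici (0 : ℝ), |f (x : ℝ)|

/-- The Poisson weights with parameter `y` sum to one. -/
theorem hasSum_exp_neg_mul_pow_div_factorial (y : ℝ) :
    HasSum (fun k : ℕ => Real.exp (-y) * y ^ k / (Nat.factorial k)) 1 := by
  have h := (NormedSpace.expSeries_div_hasSum_exp y).mul_left (Real.exp (-y))
  rw [← Real.exp_eq_exp_ℝ, ← Real.exp_add, neg_add_cancel, Real.exp_zero] at h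
  simpa only [mul_div_assoc] using h

theorem exp_neg_mul_pow_div_factorial_nonneg {y : ℝ} (hy : 0 ≤ y) (k : ℕ) :
    0 ≤ Real.exp (-y) * y ^ k / (Nat.factorial k) := by
  positivity

/-- A Poisson average is bounded by any absolutely dominating Poisson average. -/
theorem abs_tsum_poisson_mul_le {y s : ℝ} (hy : 0 ≤ y) {a b : ℕ → ℝ} (hab : ∀ k, |a k| ≤ b k)
    (hb : HasSum (fun k : ℕ => Real.exp (-y) * y ^ k / (Nat.factorial k) * b k) s) :
    |∑' k : ℕ, Real.exp (-y) * y ^ k / (Nat.factorial k) * a k| ≤ s := by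
  rw [← Real.norm_eq_abs]
  refine tsum_of_norm_bounded hb fun k => ?_
  rw [norm_mul, Real.norm_eq_abs, Real.norm_eq_abs,
    abs_of_nonneg (exp_neg_mul_pow_div_factorial_nonneg hy k)]
  exact mul_le_mul_of_nonneg_left (hab k) (exp_neg_mul_pow_div_factorial_nonneg hy k)

theorem abs_tsum_poisson_mul_le_of_bounded {y C : ℝ} (hy : 0 ≤ y) {a : ℕ → ℝ}
    (ha : ∀ k, |a k| ≤ C) :
    |∑' k : ℕ, Real.exp (-y) * y ^ k / (Nat.factorial k) * a k| ≤ C := by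
  refine abs_tsum_poisson_mul_le hy (b := fun _ => C) ha ?_
  simpa using (hasSum_exp_neg_mul_pow_div_factorial y).mul_right C

theorem continuous_tsum_poisson_mul {C : ℝ} {a : ℕ → ℝ} (ha : ∀ k, |a k| ≤ C) :
    Continuous fun y : ℝ => ∑' k : ℕ, Real.exp (-y) * y ^ k / (Nat.factorial k) * a k := by
  have key : Continuous fun y : ℝ => ∑' k : ℕ, y ^ k / (Nat.factorial k) * a k := by
    refine continuous_iff_continuousAt.2 fun y₀ => ?_
    have hmem : Metric.ball (0 : ℝ) (|y₀| + 1) ∈ nhds y₀ :=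
      Metric.isOpen_ball.mem_nhds (by simp)
    refine ContinuousOn.continuousAt ?_ hmem
    refine continuousOn_tsum (u := fun k : ℕ => (|y₀| + 1) ^ k / (Nat.factorial k) * C)
      (fun k => by fun_prop) ((Real.summable_pow_div_factorial _).mul_right C) fun k y hy => ?_
    have hy' : |y| ≤ |y₀| + 1 := by simpa using (Metric.mem_ball.1 hy).le
    rw [norm_mul, norm_div, norm_pow, Real.norm_eq_abs, Real.norm_eq_abs, Real.norm_eq_abs,
      Nat.abs_cast]
    gcongr
    exact ha k
  have heq : (fun y : ℝ => ∑' k : ℕ, Real.exp (-y) * y ^ k / (Nat.factorial k) * a k) =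
      fun y => Real.exp (-y) * ∑' k : ℕ, y ^ k / (Nat.factorial k) * a k := by
    funext y
    rw [← tsum_mul_left]
    exact tsum_congr fun k => by ring
  rw [heq]
  fun_prop

/-- Poisson averages of a null sequence vanish as the mean tends to infinity. -/
theorem tendsto_tsum_poisson_mul_atTop {a : ℕ → ℝ} (ha : Tendsto a atTop (nhds 0)) :
    Tendsto (fun y : ℝ => ∑' k : ℕ, Real.exp (-y) * y ^ k / (Nat.factorial k) * a k)
      atTop (nhds 0) := by
  rw [Metric.tendsto_atTop'] at ha
  rw [Metric.tendsto_nhds]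
  intro ε hε
  obtain ⟨K, hK⟩ := ha (ε / 2) (half_pos hε)
  have hlim : Tendsto (fun y : ℝ => ∑ k ∈ Finset.range (K + 1),
      Real.exp (-y) * y ^ k / (Nat.factorial k) * |a k|) atTop (nhds 0) := by
    rw [← Finset.sum_const_zero (s := Finset.range (K + 1))]
    refine tendsto_finsetSum _ fun k _ => ?_
    have h := (Real.tendsto_pow_mul_exp_neg_atTop_nhds_zero k).mul_const
      (|a k| / (Nat.factorial k))
    rw [zero_mul] at h
    exact h.congr fun y => by ring
  filter_upwards [hlim.eventually_lt_const (half_pos hε), eventually_ge_atTop 0] with y hy hy0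
  rw [Real.dist_eq, sub_zero]
  have hsum : HasSum (fun k : ℕ => Real.exp (-y) * y ^ k / (Nat.factorial k) *
      (ε / 2 + if k ∈ Finset.range (K + 1) then |a k| else 0))
      (ε / 2 + ∑ k ∈ Finset.range (K + 1),
        Real.exp (-y) * y ^ k / (Nat.factorial k) * |a k|) := by
    have h1 := (hasSum_exp_neg_mul_pow_div_factorial y).mul_right (ε / 2)
    have h2 : HasSum (fun k : ℕ => if k ∈ Finset.range (K + 1) then
        Real.exp (-y) * y ^ k / (Nat.factorial k) * |a k| else 0)
        (∑ k ∈ Finset.range (K + 1), if k ∈ Finset.range (K + 1) then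
          Real.exp (-y) * y ^ k / (Nat.factorial k) * |a k| else 0) :=
      hasSum_sum_of_ne_finset_zero fun k hk => if_neg hk
    rw [Finset.sum_congr rfl fun k hk => if_pos hk] at h2
    rw [one_mul] at h1
    refine (h1.add h2).congr_fun fun k => ?_
    rw [mul_add, mul_ite, mul_zero]
  refine (abs_tsum_poisson_mul_le hy0 (fun k => ?_) hsum).trans_lt (by linarith)
  split_ifs with hk
  · linarith
  · have h := hK k (by simp at hk; omega)
    rw [Real.dist_eq, sub_zero] at h
    linarith

theorem abs_le_supnorm {f : ℝ → ℝ} (hfc : ContinuousOn f (Set.Ici 0))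
    (hf0 : Tendsto f atTop (nhds 0)) {x : ℝ} (hx : 0 ≤ x) : |f x| ≤ supnorm f := by
  have hev : ∀ᶠ t in atTop, |f t| < 1 := by
    simpa using hf0.abs.eventually_lt_const (u := 1) (by simp)
  obtain ⟨M, hM⟩ := eventually_atTop.1 hev
  obtain ⟨B, hB⟩ := (isCompact_Icc (a := (0 : ℝ)) (b := M)).exists_bound_of_continuousOn
    (hfc.mono Set.Icc_subset_Ici_self)
  have hbdd : BddAbove (Set.range fun t : Set.Ici (0 : ℝ) => |f (t : ℝ)|) := by
    refine ⟨max B 1, ?_⟩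
    rintro _ ⟨⟨t, ht⟩, rfl⟩
    rcases le_total t M with h | h
    · exact (hB t ⟨ht, h⟩).trans (le_max_left _ _)
    · exact (hM t h).le.trans (le_max_right _ _)
  exact le_ciSup hbdd ⟨x, hx⟩

/-- If `f : [0,∞) → ℝ` is continuous and vanishes at infinity, then so is `𝒫ₙ f`,
and `‖𝒫ₙ f‖_∞ ≤ ‖f‖_∞`. -/
theorem szasz_maps_czero (f : ℝ → ℝ) (hfc : ContinuousOn f (Set.Ici 0))
    (hf0 : Tendsto f atTop (nhds 0)) (n : ℕ) (hn : 1 ≤ n) :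
    ContinuousOn (szasz n f) (Set.Ici 0) ∧
    Tendsto (szasz n f) atTop (nhds 0) ∧
    ∀ x ≥ (0 : ℝ), |szasz n f x| ≤ supnorm f := by
  have hn0 : (0 : ℝ) < n := by exact_mod_cast hn
  have hbound (k : ℕ) : |f ((k : ℝ) / (n : ℝ))| ≤ supnorm f :=
    abs_le_supnorm hfc hf0 (by positivity)
  have hnull : Tendsto (fun k : ℕ => f ((k : ℝ) / (n : ℝ))) atTop (nhds 0) :=
    hf0.comp (tendsto_natCast_atTop_atTop.atTop_div_const hn0)
  refine ⟨?_, ?_, fun x hx => ?_⟩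
  · exact ((continuous_tsum_poisson_mul hbound).comp (continuous_const_mul (n : ℝ))).continuousOn
  · exact (tendsto_tsum_poisson_mul_atTop hnull).comp (tendsto_id.const_mul_atTop hn0)
  · exact abs_tsum_poisson_mul_le_of_bounded (mul_nonneg hn0.le hx) hbound
end

section
/- Fix an integer n ≥ 1 and f ∈ C([0,1]). Then the k-fold iterates of the Bernstein operator satisfy lim_{k→∞} max_{x∈[0,1]} |Bₙᵏf(x) − (f(0) + (f(1) − f(0))·x)| = 0; that is, as k → ∞ with n fixed, Bₙᵏf converges uniformly on [0,1] to the affine function interpolating between f(0) and f(1). -/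
open Filter

/-- The Bernstein operator
`Bₙ f (x) = ∑_{k=0}^n C(n,k) x^k (1−x)^{n−k} f(k/n)`. -/
noncomputable def bernsteinOp (n : ℕ) (f : ℝ → ℝ) (x : ℝ) : ℝ :=
  ∑ k ∈ Finset.range (n + 1),
    (n.choose k : ℝ) * x ^ k * (1 - x) ^ (n - k) * f ((k : ℝ) / (n : ℝ))

theorem sum_choose_mul_pow (n : ℕ) (x : ℝ) :
    ∑ k ∈ Finset.range (n + 1), (n.choose k : ℝ) * x ^ k * (1 - x) ^ (n - k) = 1 := by
  simpa [bernsteinPolynomial, Polynomial.eval_finsetSum] using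
    congrArg (Polynomial.eval x) (bernsteinPolynomial.sum ℝ n)

theorem sum_choose_mul_pow_mul_index (n : ℕ) (x : ℝ) :
    ∑ k ∈ Finset.range (n + 1), (n.choose k : ℝ) * x ^ k * (1 - x) ^ (n - k) * k = n * x := by
  simpa [bernsteinPolynomial, Polynomial.eval_finsetSum, mul_comm] using
    congrArg (Polynomial.eval x) (bernsteinPolynomial.sum_smul ℝ n)

theorem sum_choose_mul_pow_mul_sq (n : ℕ) (x : ℝ) :
    ∑ k ∈ Finset.range (n + 1), (n.choose k : ℝ) * x ^ k * (1 - x) ^ (n - k) * (n * x - k) ^ 2 =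
      n * x * (1 - x) := by
  simpa [bernsteinPolynomial, Polynomial.eval_finsetSum, mul_comm, mul_assoc, mul_left_comm] using
    congrArg (Polynomial.eval x) (bernsteinPolynomial.variance ℝ n)

theorem bernsteinOp_affine {n : ℕ} (hn : n ≠ 0) (a b x : ℝ) :
    bernsteinOp n (fun y => a + b * y) x = a + b * x := by
  have h : bernsteinOp n (fun y => a + b * y) x =
      a * (∑ k ∈ Finset.range (n + 1), (n.choose k : ℝ) * x ^ k * (1 - x) ^ (n - k)) +
      b / n * ∑ k ∈ Finset.range (n + 1), (n.choose k : ℝ) * x ^ k * (1 - x) ^ (n - k) * k := by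
    rw [bernsteinOp, Finset.mul_sum, Finset.mul_sum, ← Finset.sum_add_distrib]
    exact Finset.sum_congr rfl fun k _ => by ring
  rw [h, sum_choose_mul_pow, sum_choose_mul_pow_mul_index]
  field_simp

/-- The parabola `x (1 - x)` is an eigenfunction of the Bernstein operator. -/
theorem bernsteinOp_parabola {n : ℕ} (hn : n ≠ 0) (x : ℝ) :
    bernsteinOp n (fun y => y * (1 - y)) x = (1 - 1 / n) * (x * (1 - x)) := by
  have hn' : (n : ℝ) ≠ 0 := Nat.cast_ne_zero.mpr hn
  have h : bernsteinOp n (fun y => y * (1 - y)) x =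
      x ^ 2 * (∑ k ∈ Finset.range (n + 1), (n.choose k : ℝ) * x ^ k * (1 - x) ^ (n - k)) +
      (1 - 2 * x) / n *
        (∑ k ∈ Finset.range (n + 1), (n.choose k : ℝ) * x ^ k * (1 - x) ^ (n - k) * k) -
      1 / n ^ 2 * ∑ k ∈ Finset.range (n + 1),
        (n.choose k : ℝ) * x ^ k * (1 - x) ^ (n - k) * (n * x - k) ^ 2 := by
    rw [bernsteinOp, Finset.mul_sum, Finset.mul_sum, Finset.mul_sum, ← Finset.sum_add_distrib,
      ← Finset.sum_sub_distrib]
    refine Finset.sum_congr rfl fun k _ => ?_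
    field_simp
    ring
  rw [h, sum_choose_mul_pow, sum_choose_mul_pow_mul_index, sum_choose_mul_pow_mul_sq]
  field_simp
  ring

/-- The Bernstein operator is monotone: a pointwise bound at the nodes gives a bound on `[0,1]`. -/
theorem abs_bernsteinOp_sub_le {n : ℕ} {f g w : ℝ → ℝ} {C : ℝ}
    (h : ∀ k ∈ Finset.range (n + 1), |f (k / n) - g (k / n)| ≤ C * w (k / n))
    {x : ℝ} (hx : x ∈ Set.Icc (0 : ℝ) 1) :
    |bernsteinOp n f x - bernsteinOp n g x| ≤ C * bernsteinOp n w x := by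
  have hx₀ := hx.1
  have hx₁ : 0 ≤ 1 - x := sub_nonneg.mpr hx.2
  simp only [bernsteinOp]
  rw [← Finset.sum_sub_distrib, Finset.mul_sum]
  refine (Finset.abs_sum_le_sum_abs _ _).trans (Finset.sum_le_sum fun k hk => ?_)
  have hb : 0 ≤ (n.choose k : ℝ) * x ^ k * (1 - x) ^ (n - k) := by positivity
  rw [← mul_sub, abs_mul, abs_of_nonneg hb, mul_left_comm C]
  exact mul_le_mul_of_nonneg_left (h k hk) hb

theorem node_mem_Icc {n k : ℕ} (hk : k ∈ Finset.range (n + 1)) :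
    (k / n : ℝ) ∈ Set.Icc (0 : ℝ) 1 :=
  ⟨by positivity, div_le_one_of_le₀
    (Nat.cast_le.mpr (Nat.lt_succ_iff.mp (Finset.mem_range.mp hk))) n.cast_nonneg⟩

/-- On a finite subset of `[0,1]`, a function is within a multiple of `x (1 - x)` of its affine
interpolant at the endpoints. -/
theorem exists_abs_sub_affine_le_mul_parabola (s : Finset ℝ) (hs : ∀ x ∈ s, x ∈ Set.Icc (0 : ℝ) 1)
    (f : ℝ → ℝ) :
    ∃ C : ℝ, 0 ≤ C ∧ ∀ x ∈ s, |f x - (f 0 + (f 1 - f 0) * x)| ≤ C * (x * (1 - x)) := by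
  have hw : ∀ x ∈ s, 0 ≤ x * (1 - x) := fun x hx =>
    mul_nonneg (hs x hx).1 (sub_nonneg.mpr (hs x hx).2)
  have hq : ∀ x ∈ s, 0 ≤ |f x - (f 0 + (f 1 - f 0) * x)| / (x * (1 - x)) := fun x hx =>
    div_nonneg (abs_nonneg _) (hw x hx)
  refine ⟨_, Finset.sum_nonneg hq, fun x hx => ?_⟩
  rcases (hw x hx).eq_or_lt with h0 | hpos
  · rcases mul_eq_zero.mp h0.symm with h | h
    · simp [h]
    · simp [← sub_eq_zero.mp h]
  · exact (div_le_iff₀ hpos).mp (Finset.single_le_sum hq hx)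

/-- **Kelisky–Rivlin theorem.**  For a fixed integer `n ≥ 1` and `f ∈ C([0,1])`, the iterates
`Bₙᵏ f` converge uniformly on `[0,1]`, as `k → ∞`, to the affine function
`x ↦ f(0) + (f(1) − f(0)) x`. -/
theorem kelisky_rivlin (n : ℕ) (hn : 1 ≤ n) (f : ℝ → ℝ)
    (hf : ContinuousOn f (Set.Icc 0 1)) :
    ∀ ε > (0 : ℝ), ∃ K : ℕ, ∀ k ≥ K, ∀ x ∈ Set.Icc (0 : ℝ) 1,
      |(bernsteinOp n)^[k] f x - (f 0 + (f 1 - f 0) * x)| < ε := by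
  have hn₀ : n ≠ 0 := Nat.one_le_iff_ne_zero.mp hn
  have hn₁ : (1 : ℝ) ≤ n := Nat.one_le_cast.mpr hn
  have hq₀ : (0 : ℝ) ≤ 1 - 1 / n := sub_nonneg.mpr (div_le_one_of_le₀ hn₁ n.cast_nonneg)
  have hq₁ : (1 - 1 / n : ℝ) < 1 := sub_lt_self _ (by positivity)
  intro ε hε
  obtain ⟨C, hC, hnodes⟩ := exists_abs_sub_affine_le_mul_parabola
    ((Finset.range (n + 1)).image fun k : ℕ => (k / n : ℝ))
    (Finset.forall_mem_image.mpr fun _ hk => node_mem_Icc hk) f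
  have step : ∀ (g : ℝ → ℝ) (D : ℝ),
      (∀ k ∈ Finset.range (n + 1), |g (k / n) - (f 0 + (f 1 - f 0) * (k / n))| ≤
        D * ((k / n : ℝ) * (1 - k / n))) →
      ∀ x ∈ Set.Icc (0 : ℝ) 1, |bernsteinOp n g x - (f 0 + (f 1 - f 0) * x)| ≤
        D * (1 - 1 / n) * (x * (1 - x)) := fun g D hg x hx => by
    have := abs_bernsteinOp_sub_le (f := g) (g := fun y => f 0 + (f 1 - f 0) * y)
      (w := fun y => y * (1 - y)) hg hx
    rwa [bernsteinOp_affine hn₀, bernsteinOp_parabola hn₀, ← mul_assoc] at this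
  have bound : ∀ k : ℕ, ∀ x ∈ Set.Icc (0 : ℝ) 1,
      |(bernsteinOp n)^[k + 1] f x - (f 0 + (f 1 - f 0) * x)| ≤
        C * (1 - 1 / n) ^ (k + 1) * (x * (1 - x)) := by
    intro k
    induction k with
    | zero => simpa using step f C fun k hk => hnodes _ (Finset.mem_image_of_mem _ hk)
    | succ k ih =>
      rw [Function.iterate_succ_apply', pow_succ _ (k + 1), ← mul_assoc]
      exact step _ _ fun j hj => ih _ (node_mem_Icc hj)
  have hlim : Tendsto (fun k : ℕ => C * (1 - 1 / n : ℝ) ^ k) atTop (nhds 0) := by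
    simpa using (tendsto_pow_atTop_nhds_zero_of_lt_one hq₀ hq₁).const_mul C
  obtain ⟨K, hK⟩ := eventually_atTop.mp (hlim.eventually_lt_const hε)
  refine ⟨K + 1, fun k hk x hx => ?_⟩
  obtain ⟨m, rfl⟩ : ∃ m, k = m + 1 := ⟨k - 1, by omega⟩
  refine ((bound m x hx).trans (mul_le_of_le_one_right (by positivity) ?_)).trans_lt
    (hK (m + 1) (by omega))
  nlinarith [sq_nonneg x, hx.1, hx.2]
end

section
/- Let f : [0,∞) → ℝ be twice continuously differentiable with f'' Lipschitz continuous, and suppose the series defining 𝒫ₙf converges absolutely. Then for every integer n ≥ 1 and every x ∈ [0,∞), |n(𝒫ₙf(x) − f(x)) − (x/2)f''(x)| ≤ (1/6)·Lip(f'')·(3^{3/4} x^{3/2} + x^{3/4})/√n. -/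
lemma HasSum.of_eq {f g : ℕ → ℝ} {a b : ℝ} (h : HasSum f a) (hfg : ∀ k, g k = f k)
    (hab : b = a) : HasSum g b := by
  rwa [funext hfg, hab]

/-- The weight at `k` of the Poisson distribution with parameter `y`. -/
noncomputable def poissonWeight (y : ℝ) (k : ℕ) : ℝ :=
  Real.exp (-y) * y ^ k / (Nat.factorial k)

lemma poissonWeight_nonneg {y : ℝ} (hy : 0 ≤ y) (k : ℕ) : 0 ≤ poissonWeight y k := by
  unfold poissonWeight
  positivity

lemma hasSum_poissonWeight (y : ℝ) : HasSum (poissonWeight y) 1 := by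
  have h := (NormedSpace.expSeries_div_hasSum_exp y).mul_left (Real.exp (-y))
  rw [← Real.exp_eq_exp_ℝ, ← Real.exp_add, neg_add_cancel, Real.exp_zero] at h
  exact h.of_eq (fun k => mul_div_assoc _ _ _) rfl

/-- The Stein–Chen identity `E[N g(N)] = y E[g(N + 1)]` for a Poisson variable `N`. -/
lemma hasSum_poissonWeight_mul_natCast {y a : ℝ} {g : ℝ → ℝ}
    (h : HasSum (fun k : ℕ => poissonWeight y k * g (k + 1)) a) :
    HasSum (fun k : ℕ => poissonWeight y k * (k * g k)) (y * a) := by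
  rw [← hasSum_nat_add_iff' 1]
  refine (h.mul_left y).of_eq (fun k => ?_) (by simp)
  have : (k.factorial : ℝ) ≠ 0 := by positivity
  have : (k : ℝ) + 1 ≠ 0 := by positivity
  simp only [poissonWeight, Nat.factorial_succ]
  push_cast
  field_simp
  ring

lemma hasSum_poissonWeight_moments (y : ℝ) :
    HasSum (fun k : ℕ => poissonWeight y k * (k - y)) 0 ∧
    HasSum (fun k : ℕ => poissonWeight y k * (k - y) ^ 2) y ∧
    HasSum (fun k : ℕ => poissonWeight y k * (k - y) ^ 4) (3 * y ^ 2 + y) := by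
  have h0 := hasSum_poissonWeight y
  have h1 := hasSum_poissonWeight_mul_natCast (g := fun _ => 1) (by simpa using h0)
  have h2 := hasSum_poissonWeight_mul_natCast (y := y) (g := fun t => t)
    ((h1.add h0).of_eq (fun k => by ring) rfl)
  have h3 := hasSum_poissonWeight_mul_natCast (y := y) (g := fun t => t ^ 2)
    (((h2.add (h1.mul_left 2)).add h0).of_eq (fun k => by ring) rfl)
  have h4 := hasSum_poissonWeight_mul_natCast (y := y) (g := fun t => t ^ 3)
    ((((h3.add (h2.mul_left 3)).add (h1.mul_left 3)).add h0).of_eq (fun k => by ring) rfl)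
  refine ⟨?_, ?_, ?_⟩
  · exact (h1.sub (h0.mul_left y)).of_eq (fun k => by ring) (by ring)
  · exact ((h2.sub (h1.mul_left (2 * y))).add (h0.mul_left (y ^ 2))).of_eq
      (fun k => by ring) (by ring)
  · exact ((((h4.sub (h3.mul_left (4 * y))).add (h2.mul_left (6 * y ^ 2))).sub
      (h1.mul_left (4 * y ^ 3))).add (h0.mul_left (y ^ 4))).of_eq
      (fun k => by ring) (by ring)

/-- A function on a convex set of reals that vanishes at `x` and whose derivative is bounded by
`C |t - x| ^ m` is bounded by `C / (m + 1) |t - x| ^ (m + 1)`. -/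
lemma abs_le_of_abs_deriv_le_pow {s : Set ℝ} (hs : Convex ℝ s) {φ φ' : ℝ → ℝ} {x C : ℝ}
    (m : ℕ) (hx : x ∈ s) (h0 : φ x = 0) (hφ : ∀ t ∈ s, HasDerivWithinAt φ (φ' t) s t)
    (hb : ∀ t ∈ s, |φ' t| ≤ C * |t - x| ^ m) {t : ℝ} (ht : t ∈ s) :
    |φ t| ≤ C / (m + 1) * |t - x| ^ (m + 1) := by
  set l : ℝ → ℝ := fun r => x + r * (t - x) with hl
  have hmaps : Set.MapsTo l (Set.Icc 0 1) s := fun r hr =>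
    hs.add_smul_sub_mem hx ht hr
  have hld (r : ℝ) : HasDerivAt l (t - x) r := by
    simpa only [one_mul] using ((hasDerivAt_id' r).mul_const (t - x)).const_add x
  have hd : ∀ r ∈ Set.Icc (0 : ℝ) 1,
      HasDerivWithinAt (φ ∘ l) (φ' (l r) * (t - x)) (Set.Icc 0 1) r := fun r hr =>
    (hφ _ (hmaps hr)).comp r (hld r).hasDerivWithinAt hmaps
  have hm : (m : ℝ) + 1 ≠ 0 := by positivity
  have key := image_norm_le_of_norm_deriv_right_le_deriv_boundary (f := φ ∘ l)
    (B := fun r => C / (m + 1) * |t - x| ^ (m + 1) * r ^ (m + 1))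
    (B' := fun r => C * |t - x| ^ (m + 1) * r ^ m)
    (fun r hr => (hd r hr).continuousWithinAt)
    (fun r hr => (hd r ⟨hr.1, hr.2.le⟩).mono_of_mem_nhdsWithin (Icc_mem_nhdsGE_of_mem hr))
    (by simp [hl, h0])
    (fun r => by
      refine ((hasDerivAt_pow (m + 1) r).const_mul
        (C / (m + 1) * |t - x| ^ (m + 1))).congr_deriv ?_
      rw [Nat.add_sub_cancel]
      push_cast
      field_simp)
    (fun r hr => by
      have h := hb _ (hmaps ⟨hr.1, hr.2.le⟩)
      rw [show l r - x = r * (t - x) by simp [hl], abs_mul, abs_of_nonneg hr.1] at h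
      rw [norm_mul, Real.norm_eq_abs, Real.norm_eq_abs]
      calc _ ≤ C * (r * |t - x|) ^ m * |t - x| := by gcongr
        _ = _ := by ring)
    (Set.right_mem_Icc.2 zero_le_one)
  simpa [hl] using key

lemma abs_sub_taylor_two_le {s : Set ℝ} (hs : Convex ℝ s) {f f₁ f₂ : ℝ → ℝ} {K : NNReal}
    (hf : ∀ t ∈ s, HasDerivWithinAt f (f₁ t) s t) (hf₁ : ∀ t ∈ s, HasDerivWithinAt f₁ (f₂ t) s t)
    (hK : LipschitzOnWith K f₂ s) {x t : ℝ} (hx : x ∈ s) (ht : t ∈ s) :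
    |f t - f x - f₁ x * (t - x) - f₂ x / 2 * (t - x) ^ 2| ≤ K / 6 * |t - x| ^ 3 := by
  have h1 : ∀ t ∈ s, |f₁ t - f₁ x - f₂ x * (t - x)| ≤ K / 2 * |t - x| ^ 2 := by
    intro t ht
    have := abs_le_of_abs_deriv_le_pow hs (φ := fun t => f₁ t - f₁ x - f₂ x * (t - x))
      (φ' := fun t => f₂ t - f₂ x) (C := K) 1 hx (by simp)
      (fun t ht => by
        simpa only [mul_one] using ((hf₁ t ht).sub_const (f₁ x)).fun_sub
          (((hasDerivAt_id' t).hasDerivWithinAt.sub_const x).const_mul (f₂ x)))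
      (fun t ht => by simpa [Real.dist_eq] using hK.dist_le_mul t ht x hx) ht
    norm_num at this ⊢
    exact this
  have := abs_le_of_abs_deriv_le_pow hs
    (φ := fun t => f t - f x - f₁ x * (t - x) - f₂ x / 2 * (t - x) ^ 2)
    (φ' := fun t => f₁ t - f₁ x - f₂ x * (t - x)) (C := K / 2) 2 hx (by simp)
    (fun t ht => by
      refine ((((hf t ht).sub_const (f x)).fun_sub
        (((hasDerivAt_id' t).hasDerivWithinAt.sub_const x).const_mul (f₁ x))).fun_sub
        ((((hasDerivAt_id' t).hasDerivWithinAt.sub_const x).fun_pow 2).const_mul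
          (f₂ x / 2))).congr_deriv ?_
      norm_num
      ring)
    h1 ht
  convert this using 2
  push_cast
  ring

/-- Weighted form of Young's inequality interpolating the cube between the fourth power and a
constant. -/
lemma cube_le_of_pos {c d : ℝ} (hc : 0 < c) :
    d ^ 3 ≤ 3 / (4 * c) * d ^ 4 + c ^ 3 / 4 := by
  have h : 0 ≤ (d - c) ^ 2 * (3 * d ^ 2 + 2 * d * c + c ^ 2) :=
    mul_nonneg (sq_nonneg _) (by nlinarith [sq_nonneg (d + c), sq_nonneg d])
  rw [← sub_nonneg]
  have : 3 / (4 * c) * d ^ 4 + c ^ 3 / 4 - d ^ 3 =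
      (d - c) ^ 2 * (3 * d ^ 2 + 2 * d * c + c ^ 2) / (4 * c) := by
    field_simp
    ring
  rw [this]
  positivity

lemma three_quarters_rpow_moment_le {n x : ℝ} (hn : 1 ≤ n) (hx : 0 ≤ x) :
    n * ((3 * (n * x) ^ 2 + n * x) / n ^ 4) ^ ((3 : ℝ) / 4) ≤
      ((3 : ℝ) ^ ((3 : ℝ) / 4) * x ^ ((3 : ℝ) / 2) + x ^ ((3 : ℝ) / 4)) / Real.sqrt n := by
  have hn0 : 0 < n := by linarith
  have h1 : (3 * (n * x) ^ 2 + n * x) / n ^ 4 = (3 * x ^ 2 + x / n) / n ^ (2 : ℝ) := by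
    rw [Real.rpow_two]
    field_simp
  have h2 : n * (n ^ ((3 : ℝ) / 2))⁻¹ = (Real.sqrt n)⁻¹ := by
    rw [← Real.rpow_neg hn0.le, Real.sqrt_eq_rpow, ← Real.rpow_neg hn0.le,
      ← Real.rpow_one_add' hn0.le (by norm_num)]
    norm_num
  have h3 : (3 * x ^ 2 + x / n) ^ ((3 : ℝ) / 4) ≤
      (3 : ℝ) ^ ((3 : ℝ) / 4) * x ^ ((3 : ℝ) / 2) + x ^ ((3 : ℝ) / 4) := by
    calc _ ≤ (3 * x ^ 2 + x) ^ ((3 : ℝ) / 4) := by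
          gcongr
          exact div_le_self hx hn
      _ ≤ (3 * x ^ 2) ^ ((3 : ℝ) / 4) + x ^ ((3 : ℝ) / 4) :=
          Real.rpow_add_le_add_rpow (by positivity) hx (by norm_num) (by norm_num)
      _ = _ := by
          rw [Real.mul_rpow (by norm_num) (by positivity), ← Real.rpow_two, ← Real.rpow_mul hx]
          norm_num
  rw [h1, Real.div_rpow (by positivity) (by positivity), ← Real.rpow_mul hn0.le,
    show (2 : ℝ) * (3 / 4) = 3 / 2 by norm_num]
  calc _ = (3 * x ^ 2 + x / n) ^ ((3 : ℝ) / 4) * (n * (n ^ ((3 : ℝ) / 2))⁻¹) := by ring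
    _ ≤ _ := by
      rw [h2, ← div_eq_mul_inv]
      gcongr


open Filter

/-- **Pointwise quantitative Voronovskaya estimate.**  Let `f : [0,∞) → ℝ` be twice continuously
differentiable with `f''` Lipschitz (with constant `K`), and suppose the series defining
`𝒫ₙ f` converges absolutely.  Then for every integer `n ≥ 1` and every `x ≥ 0`,
`|n (𝒫ₙ f(x) − f(x)) − (x/2) f''(x)| ≤ (1/6) K (3^{3/4} x^{3/2} + x^{3/4}) / √n`. -/
theorem szasz_voronovskaya_pointwise (f : ℝ → ℝ) (K : NNReal)
    (hf : ContDiffOn ℝ 2 f (Set.Ici 0))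
    (hK : LipschitzOnWith K (iteratedDerivWithin 2 f (Set.Ici 0)) (Set.Ici 0))
    (hsum : ∀ n : ℕ, 1 ≤ n → ∀ x ≥ (0 : ℝ), Summable (fun k : ℕ =>
      |Real.exp (-((n : ℝ) * x)) * ((n : ℝ) * x) ^ k / (Nat.factorial k) *
        f ((k : ℝ) / (n : ℝ))|)) :
    ∀ n : ℕ, 1 ≤ n → ∀ x ≥ (0 : ℝ),
      |(n : ℝ) * (szasz n f x - f x) - x / 2 * iteratedDerivWithin 2 f (Set.Ici 0) x|
        ≤ 1 / 6 * K * ((3 : ℝ) ^ ((3 : ℝ) / 4) * x ^ ((3 : ℝ) / 2) + x ^ ((3 : ℝ) / 4))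
            / Real.sqrt n := by
  intro n hn x hx
  have hn1 : (1 : ℝ) ≤ n := by exact_mod_cast hn
  have hn0 : (0 : ℝ) < n := by linarith
  set f₁ := iteratedDerivWithin 1 f (Set.Ici 0) with hf₁
  set f₂ := iteratedDerivWithin 2 f (Set.Ici 0) with hf₂
  have hu : UniqueDiffOn ℝ (Set.Ici (0 : ℝ)) := uniqueDiffOn_Ici 0
  have hd : ∀ t ∈ Set.Ici (0 : ℝ), HasDerivWithinAt f (f₁ t) (Set.Ici 0) t := fun t ht => by
    rw [hf₁, iteratedDerivWithin_one]
    exact (hf.differentiableOn (by norm_num) t ht).hasDerivWithinAt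
  have hd₁ : ∀ t ∈ Set.Ici (0 : ℝ), HasDerivWithinAt f₁ (f₂ t) (Set.Ici 0) t := fun t ht => by
    rw [hf₂, iteratedDerivWithin_succ]
    exact (hf.differentiableOn_iteratedDerivWithin (by norm_num) hu t ht).hasDerivWithinAt
  set y : ℝ := n * x with hy
  have hy0 : 0 ≤ y := by positivity
  have hdev (k : ℕ) : (k : ℝ) / n - x = (k - y) / n := by
    rw [hy]
    field_simp
  obtain ⟨m1, m2, m4⟩ := hasSum_poissonWeight_moments y
  have m0 := hasSum_poissonWeight y
  have hS : HasSum (fun k : ℕ => poissonWeight y k * f (k / n)) (szasz n f x) :=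
    (hsum n hn x hx).of_abs.hasSum
  have hR : HasSum (fun k : ℕ => poissonWeight y k * (f (k / n) - f x - f₁ x * (k / n - x) -
      f₂ x / 2 * (k / n - x) ^ 2)) (szasz n f x - f x - f₂ x / 2 * (x / n)) := by
    refine (((hS.sub (m0.mul_right (f x))).sub (m1.mul_right (f₁ x / n))).sub
      (m2.mul_right (f₂ x / 2 / n ^ 2))).of_eq (fun k => ?_) ?_
    · rw [hdev]
      ring
    · rw [hy]
      field_simp
      ring
  have hE : (n : ℝ) * (szasz n f x - f x) - x / 2 * f₂ x =
      n * (szasz n f x - f x - f₂ x / 2 * (x / n)) := by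
    field_simp
  set M : ℝ := (3 * y ^ 2 + y) / n ^ 4 with hM
  have hM0 : 0 ≤ M := by positivity
  have hbound : |szasz n f x - f x - f₂ x / 2 * (x / n)| ≤ K / 6 * M ^ ((3 : ℝ) / 4) := by
    rcases hx.eq_or_lt with rfl | hx0
    · have h0 : y = 0 := by rw [hy, mul_zero]
      have : HasSum (fun k : ℕ => poissonWeight y k * f (k / n)) (f 0) := by
        refine (hasSum_single 0 fun k hk => ?_).of_eq (fun _ => rfl) ?_
        · simp [poissonWeight, h0, hk]
        · simp [poissonWeight, h0]
      rw [hS.unique this]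
      simp only [sub_self, zero_div, mul_zero, abs_zero]
      positivity
    · have hMpos : 0 < M := by positivity
      set c : ℝ := M ^ ((1 : ℝ) / 4) with hc
      have hc0 : 0 < c := by positivity
      have hc4 : c ^ 4 = M := by
        rw [hc, ← Real.rpow_natCast, ← Real.rpow_mul hM0]
        norm_num
      have hc3 : c ^ 3 = M ^ ((3 : ℝ) / 4) := by
        rw [hc, ← Real.rpow_natCast, ← Real.rpow_mul hM0]
        norm_num
      have hB := ((m4.mul_right (3 / (4 * c) / (n : ℝ) ^ 4)).add
        (m0.mul_right (c ^ 3 / 4))).mul_left (K / 6 : ℝ)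
      have hval : (3 * y ^ 2 + y) * (3 / (4 * c) / (n : ℝ) ^ 4) + 1 * (c ^ 3 / 4) = c ^ 3 := by
        rw [show (3 * y ^ 2 + y) * (3 / (4 * c) / (n : ℝ) ^ 4) = M * (3 / (4 * c)) by
          rw [hM]; ring, ← hc4]
        field_simp
        ring
      rw [hval, hc3] at hB
      rw [← hR.tsum_eq, ← Real.norm_eq_abs]
      refine tsum_of_norm_bounded hB fun k => ?_
      have hp := poissonWeight_nonneg hy0 k
      have hT := abs_sub_taylor_two_le (convex_Ici 0) hd hd₁ hK (x := x) (t := (k : ℝ) / n) hx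
        (Set.mem_Ici.2 (by positivity))
      have hY := cube_le_of_pos (d := |(k : ℝ) / n - x|) hc0
      rw [Even.pow_abs (by decide : Even 4)] at hY
      rw [norm_mul, Real.norm_of_nonneg hp, Real.norm_eq_abs]
      calc _ ≤ poissonWeight y k * (K / 6 *
            (3 / (4 * c) * ((k : ℝ) / n - x) ^ 4 + c ^ 3 / 4)) := by
            gcongr
            exact hT.trans (by gcongr)
        _ = _ := by
            rw [hdev, hc3]
            ring
  rw [hE, abs_mul, abs_of_pos hn0]
  calc _ ≤ (n : ℝ) * (K / 6 * M ^ ((3 : ℝ) / 4)) := by gcongr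
    _ = K / 6 * (n * M ^ ((3 : ℝ) / 4)) := by ring
    _ ≤ K / 6 * (((3 : ℝ) ^ ((3 : ℝ) / 4) * x ^ ((3 : ℝ) / 2) + x ^ ((3 : ℝ) / 4)) /
          Real.sqrt n) := by
        gcongr
        exact three_quarters_rpow_moment_le hn1 hx
    _ = _ := by ring
end

section
/- Let U be a real Banach space and (Tₙ)_{n≥1} a sequence of continuous linear operators on U with operator norm ‖Tₙ‖ ≤ 1 for all n. Let D be a dense linear subspace of U and A : D → U a linear map such that for every f ∈ D, n(Tₙf − f) → Af in U as n → ∞. Assume that for some λ > 0 the set {λf − Af : f ∈ D} is dense in U. Then there exists a family (S_t)_{t≥0} of continuous linear operators on U with S_0 the identity, S_{t+s} = S_t ∘ S_s for all s, t ≥ 0, ‖S_t‖ ≤ 1 for all t ≥ 0, the map t ↦ S_t f continuous for every f ∈ U, and such that for every t ≥ 0 and every f ∈ U, Tₙ^{⌊nt⌋}f → S_t f in U as n → ∞, where Tₙ^{⌊nt⌋} denotes the ⌊nt⌋-fold iterate of Tₙ. -/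
open Filter

section Resolvents

variable {U : Type*} [NormedAddCommGroup U] [NormedSpace ℝ U]

/-- `J` is the resolvent `(1 - s (T - 1))⁻¹`; it is required to be a contraction. -/
structure IsContractiveResolvent (T : U →L[ℝ] U) (s : ℝ) (J : U →L[ℝ] U) : Prop where
  commute : Commute T J
  norm_apply_le : ∀ x, ‖J x‖ ≤ ‖x‖
  apply_right : ∀ x, J x - s • (T (J x) - J x) = x
  apply_left : ∀ x, J (x - s • (T x - x)) = x

theorem exists_isContractiveResolvent [CompleteSpace U] {T : U →L[ℝ] U} (hT : ‖T‖ ≤ 1) {s : ℝ}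
    (hs : 0 ≤ s) : ∃ J, IsContractiveResolvent T s J := by
  have h1s : 0 < 1 + s := by linarith
  have hlt : ‖(s / (1 + s)) • T‖ < 1 := by
    rw [norm_smul, Real.norm_of_nonneg (by positivity)]
    calc s / (1 + s) * ‖T‖ ≤ s / (1 + s) * 1 := by gcongr
      _ < 1 := by rw [mul_one, div_lt_one h1s]; linarith
  obtain ⟨u, hu⟩ := isUnit_one_sub_of_norm_lt_one hlt
  have hcomm : Commute T (u : U →L[ℝ] U) := by
    rw [hu]
    exact (Commute.one_right T).sub_right ((Commute.refl T).smul_right _)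
  have hu_apply : ∀ x, x - s • (T x - x) = (1 + s) • (u : U →L[ℝ] U) x := by
    intro x
    have : (1 + s) * (s / (1 + s)) = s := by field_simp
    simp only [hu, sub_apply, one_apply_eq_self,
      smul_apply, smul_sub, smul_smul, this]
    module
  have hleft : ∀ x, (↑u⁻¹ : U →L[ℝ] U) ((u : U →L[ℝ] U) x) = x := fun x => by
    rw [← mul_apply_eq_comp, u.inv_mul, one_apply_eq_self]
  have hright : ∀ x, (u : U →L[ℝ] U) ((↑u⁻¹ : U →L[ℝ] U) x) = x := fun x => by
    rw [← mul_apply_eq_comp, u.mul_inv, one_apply_eq_self]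
  have happ : ∀ x, ((1 + s)⁻¹ • (↑u⁻¹ : U →L[ℝ] U)) x
      - s • (T (((1 + s)⁻¹ • (↑u⁻¹ : U →L[ℝ] U)) x) - ((1 + s)⁻¹ • (↑u⁻¹ : U →L[ℝ] U)) x) = x := by
    intro x
    rw [hu_apply, smul_apply, map_smul, hright, smul_smul,
      mul_inv_cancel₀ h1s.ne', one_smul]
  refine ⟨(1 + s)⁻¹ • (↑u⁻¹ : U →L[ℝ] U), ⟨hcomm.units_inv_right.smul_right _, ?_, happ, ?_⟩⟩
  · intro x
    have h := happ x
    set y := ((1 + s)⁻¹ • (↑u⁻¹ : U →L[ℝ] U)) x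
    have hy : (1 + s) • y = x + s • T y := by
      rw [← sub_eq_iff_eq_add, ← h]
      module
    have h1 : (1 + s) * ‖y‖ ≤ ‖x‖ + s * ‖y‖ := by
      calc (1 + s) * ‖y‖ = ‖(1 + s) • y‖ := by rw [norm_smul, Real.norm_of_nonneg h1s.le]
        _ ≤ ‖x‖ + ‖s • T y‖ := by rw [hy]; exact norm_add_le _ _
        _ ≤ ‖x‖ + s * ‖y‖ := by
          rw [norm_smul, Real.norm_of_nonneg hs]
          gcongr
          simpa using T.le_of_opNorm_le hT y
    linarith
  · intro x
    rw [hu_apply, smul_apply, map_smul, hleft, smul_smul,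
      inv_mul_cancel₀ h1s.ne', one_smul]

theorem norm_pow_apply_le {T : U →L[ℝ] U} (hT : ∀ x, ‖T x‖ ≤ ‖x‖) (m : ℕ) (x : U) :
    ‖(T ^ m) x‖ ≤ ‖x‖ := by
  induction m with
  | zero => simp
  | succ m ih =>
    rw [pow_succ', mul_apply_eq_comp]
    exact (hT _).trans ih

theorem norm_pow_apply_sub_le {T : U →L[ℝ] U} (hT : ∀ x, ‖T x‖ ≤ ‖x‖) (m : ℕ) (x : U) :
    ‖(T ^ m) x - x‖ ≤ m * ‖T x - x‖ := by
  induction m with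
  | zero => simp
  | succ m ih =>
    have : (T ^ (m + 1)) x - x = (T ^ m) (T x - x) + ((T ^ m) x - x) := by
      rw [pow_succ, mul_apply_eq_comp, map_sub]; abel
    rw [this, Nat.cast_succ]
    linarith [norm_add_le ((T ^ m) (T x - x)) ((T ^ m) x - x), norm_pow_apply_le hT m (T x - x)]

theorem norm_pow_apply_sub_pow_apply_le {T : U →L[ℝ] U} (hT : ∀ x, ‖T x‖ ≤ ‖x‖) (i j : ℕ)
    (x : U) : ‖(T ^ i) x - (T ^ j) x‖ ≤ |(i : ℝ) - j| * ‖T x - x‖ := by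
  wlog hij : j ≤ i generalizing i j
  · rw [norm_sub_rev, abs_sub_comm]
    exact this j i (by omega)
  obtain ⟨d, rfl⟩ := Nat.exists_eq_add_of_le hij
  have : (T ^ (j + d)) x - (T ^ j) x = (T ^ j) ((T ^ d) x - x) := by
    rw [pow_add, mul_apply_eq_comp, map_sub]
  rw [this, Nat.cast_add, add_sub_cancel_left, abs_of_nonneg (by positivity)]
  exact (norm_pow_apply_le hT _ _).trans (norm_pow_apply_sub_le hT d x)

theorem norm_pow_apply_sub_sub_smul_le {T : U →L[ℝ] U} (hT : ∀ x, ‖T x‖ ≤ ‖x‖) (m : ℕ) (x : U) :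
    ‖(T ^ m) x - x - (m : ℝ) • (T x - x)‖ ≤ (m : ℝ) ^ 2 * ‖T (T x - x) - (T x - x)‖ := by
  induction m with
  | zero => simp
  | succ m ih =>
    have : (T ^ (m + 1)) x - x - ((m + 1 : ℕ) : ℝ) • (T x - x) =
        ((T ^ m) x - x - (m : ℝ) • (T x - x)) + ((T ^ m) (T x - x) - (T x - x)) := by
      rw [pow_succ, mul_apply_eq_comp, map_sub]
      push_cast
      module
    rw [this]
    have h1 := norm_pow_apply_sub_le hT m (T x - x)
    have h2 := norm_add_le ((T ^ m) x - x - (m : ℝ) • (T x - x))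
      ((T ^ m) (T x - x) - (T x - x))
    rw [Nat.cast_succ]
    nlinarith [norm_nonneg (T (T x - x) - (T x - x)), (m.cast_nonneg : (0 : ℝ) ≤ m)]

theorem norm_pow_apply_sub_pow_apply_le_of_commute {B C : U →L[ℝ] U} (hBC : Commute B C)
    (hB : ∀ x, ‖B x‖ ≤ ‖x‖) (hC : ∀ x, ‖C x‖ ≤ ‖x‖) (k : ℕ) (x : U) :
    ‖(B ^ k) x - (C ^ k) x‖ ≤ k * ‖B x - C x‖ := by
  induction k with
  | zero => simp
  | succ k ih =>
    have h : (B ^ (k + 1)) x - (C ^ (k + 1)) x =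
        (B ^ k) (B x - C x) + C ((B ^ k) x - (C ^ k) x) := by
      have : (B ^ k) (C x) = C ((B ^ k) x) := by
        rw [← mul_apply_eq_comp, ← mul_apply_eq_comp,
          (hBC.pow_left k).eq]
      rw [pow_succ, pow_succ', mul_apply_eq_comp, mul_apply_eq_comp,
        map_sub, map_sub, this]
      abel
    rw [h, Nat.cast_succ]
    linarith [norm_add_le ((B ^ k) (B x - C x)) (C ((B ^ k) x - (C ^ k) x)),
      norm_pow_apply_le hB k (B x - C x), hC ((B ^ k) x - (C ^ k) x)]

namespace IsContractiveResolvent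

variable {T J : U →L[ℝ] U} {s : ℝ}

theorem apply_comm (hJ : IsContractiveResolvent T s J) (x : U) : T (J x) = J (T x) := by
  rw [← mul_apply_eq_comp, hJ.commute.eq, mul_apply_eq_comp]

theorem apply_sub (hJ : IsContractiveResolvent T s J) (x : U) :
    J x - x = s • J (T x - x) := by
  have h := hJ.apply_right x
  rw [hJ.apply_comm, ← map_sub] at h
  nth_rewrite 2 [← h]
  abel

theorem norm_apply_sub_sub_smul_le (hJ : IsContractiveResolvent T s J) (x : U) :
    ‖J x - x - s • (T x - x)‖ ≤ s ^ 2 * ‖T (T x - x) - (T x - x)‖ := by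
  have h : J x - x - s • (T x - x) = s ^ 2 • J (T (T x - x) - (T x - x)) := by
    rw [hJ.apply_sub x, ← smul_sub, hJ.apply_sub (T x - x), smul_smul, sq]
  rw [h, norm_smul, Real.norm_of_nonneg (sq_nonneg s)]
  gcongr
  exact hJ.norm_apply_le _

theorem norm_pow_floor_apply_sub_le (hJ : IsContractiveResolvent T s J)
    (hT : ∀ x, ‖T x‖ ≤ ‖x‖) (hs : 0 ≤ s) (k : ℕ) (x : U) :
    ‖(T ^ ⌊k * s⌋₊) x - (J ^ k) x‖ ≤
      2 * k * s ^ 2 * ‖T (T x - x) - (T x - x)‖ + 2 * k * ‖T x - x‖ := by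
  set m := ⌊s⌋₊ with hm
  have hms : (m : ℝ) ≤ s := Nat.floor_le hs
  have hsm : s < m + 1 := Nat.lt_floor_add_one s
  have hstep : ‖(T ^ m) x - J x‖ ≤
      2 * s ^ 2 * ‖T (T x - x) - (T x - x)‖ + ‖T x - x‖ := by
    have h : (T ^ m) x - J x = ((T ^ m) x - x - (m : ℝ) • (T x - x))
        - (J x - x - s • (T x - x)) - (s - m) • (T x - x) := by module
    have h3 : ‖(s - m) • (T x - x)‖ ≤ ‖T x - x‖ := by
      rw [norm_smul, Real.norm_of_nonneg (by linarith)]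
      exact mul_le_of_le_one_left (norm_nonneg _) (by linarith)
    have h4 : (m : ℝ) ^ 2 * ‖T (T x - x) - (T x - x)‖ ≤
        s ^ 2 * ‖T (T x - x) - (T x - x)‖ := by gcongr
    rw [h]
    linarith [norm_sub_le ((T ^ m) x - x - (m : ℝ) • (T x - x) - (J x - x - s • (T x - x)))
      ((s - m) • (T x - x)), norm_sub_le ((T ^ m) x - x - (m : ℝ) • (T x - x))
      (J x - x - s • (T x - x)), norm_pow_apply_sub_sub_smul_le hT m x,
      hJ.norm_apply_sub_sub_smul_le x]
  have hpow := norm_pow_apply_sub_pow_apply_le_of_commute (hJ.commute.pow_left m)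
    (norm_pow_apply_le hT m) hJ.norm_apply_le k x
  have hfloor : ‖(T ^ ⌊k * s⌋₊) x - ((T ^ m) ^ k) x‖ ≤ k * ‖T x - x‖ := by
    rw [← pow_mul]
    refine (norm_pow_apply_sub_pow_apply_le hT _ _ x).trans ?_
    gcongr
    have hk : (0 : ℝ) ≤ k := k.cast_nonneg
    have h1 : (⌊k * s⌋₊ : ℝ) ≤ k * s := Nat.floor_le (by positivity)
    have h2 : m * k ≤ ⌊k * s⌋₊ := Nat.le_floor (by push_cast; nlinarith)
    have h2' : ((m * k : ℕ) : ℝ) ≤ (⌊k * s⌋₊ : ℝ) := by exact_mod_cast h2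
    rw [abs_of_nonneg (by linarith)]
    push_cast
    nlinarith
  have hmul : (k : ℝ) * ‖(T ^ m) x - J x‖ ≤
      k * (2 * s ^ 2 * ‖T (T x - x) - (T x - x)‖ + ‖T x - x‖) := by gcongr
  linarith [norm_sub_le_norm_sub_add_norm_sub ((T ^ ⌊k * s⌋₊) x) (((T ^ m) ^ k) x) ((J ^ k) x)]

theorem norm_map_apply_sub_le (hJ : IsContractiveResolvent T s J) (hs : 0 < s) (x : U) :
    ‖T (J x) - J x‖ ≤ 2 * ‖x‖ / s := by
  have h : s • (T (J x) - J x) = J x - x := by rw [hJ.apply_sub, hJ.apply_comm, map_sub]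
  have h1 : s * ‖T (J x) - J x‖ ≤ 2 * ‖x‖ := by
    calc s * ‖T (J x) - J x‖ = ‖J x - x‖ := by
          rw [← h, norm_smul, Real.norm_of_nonneg hs.le]
      _ ≤ 2 * ‖x‖ := by linarith [norm_sub_le (J x) x, hJ.norm_apply_le x]
  rw [le_div_iff₀ hs]
  linarith

theorem norm_pow_floor_apply_sub_le_of_smoothed {J₀ : U →L[ℝ] U} {s₀ : ℝ}
    (hJ : IsContractiveResolvent T s J) (hJ₀ : IsContractiveResolvent T s₀ J₀)
    (hT : ∀ x, ‖T x‖ ≤ ‖x‖) (hs : 0 ≤ s) (hs₀ : 0 < s₀) (k : ℕ) (g : U) :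
    ‖(T ^ ⌊k * s⌋₊) (J₀ (J₀ g)) - (J ^ k) (J₀ (J₀ g))‖ ≤
      8 * k * (s / s₀) ^ 2 * ‖g‖ + 4 * k * ‖g‖ / s₀ := by
  have h1 : ‖T (J₀ (J₀ g)) - J₀ (J₀ g)‖ ≤ 2 * ‖g‖ / s₀ := by
    refine (hJ₀.norm_map_apply_sub_le hs₀ _).trans ?_
    gcongr
    exact hJ₀.norm_apply_le g
  have h2 : ‖T (T (J₀ (J₀ g)) - J₀ (J₀ g)) - (T (J₀ (J₀ g)) - J₀ (J₀ g))‖ ≤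
      2 * (2 * ‖g‖ / s₀) / s₀ := by
    have : T (J₀ (J₀ g)) - J₀ (J₀ g) = J₀ (T (J₀ g) - J₀ g) := by
      rw [hJ₀.apply_comm (J₀ g), map_sub]
    rw [this]
    refine (hJ₀.norm_map_apply_sub_le hs₀ _).trans ?_
    gcongr
    exact hJ₀.norm_map_apply_sub_le hs₀ g
  refine (hJ.norm_pow_floor_apply_sub_le hT hs k _).trans ?_
  calc _ ≤ 2 * k * s ^ 2 * (2 * (2 * ‖g‖ / s₀) / s₀) + 2 * k * (2 * ‖g‖ / s₀) := by gcongr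
    _ = _ := by field_simp; ring

end IsContractiveResolvent

end Resolvents

section StrongConvergence

theorem exists_tendsto_of_approx {U : Type*} [NormedAddCommGroup U] [CompleteSpace U] {x : ℕ → U}
    (h : ∀ ε > 0, ∃ y : ℕ → U, (∃ l, Tendsto y atTop (nhds l)) ∧
      ∀ᶠ n in atTop, ‖x n - y n‖ ≤ ε) :
    ∃ l, Tendsto x atTop (nhds l) := by
  apply cauchySeq_tendsto_of_complete
  rw [Metric.cauchySeq_iff']
  intro ε hε
  obtain ⟨y, ⟨l, hl⟩, hy⟩ := h (ε / 5) (by positivity)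
  have hl' := (Metric.tendsto_nhds.1 hl) (ε / 5) (by positivity)
  obtain ⟨N, hN⟩ := eventually_atTop.1 (hy.and hl')
  have hx : ∀ n ≥ N, ‖x n - l‖ < 2 * ε / 5 := by
    intro n hn
    obtain ⟨h1, h2⟩ := hN n hn
    rw [dist_eq_norm] at h2
    linarith [norm_sub_le_norm_sub_add_norm_sub (x n) (y n) l]
  refine ⟨N, fun n hn => ?_⟩
  rw [dist_eq_norm]
  have h1 := hx n hn
  have h2 := hx N le_rfl
  rw [norm_sub_rev] at h2
  linarith [norm_sub_le_norm_sub_add_norm_sub (x n) l (x N)]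

variable {U : Type*} [NormedAddCommGroup U] [NormedSpace ℝ U] {B : ℕ → U →L[ℝ] U}

theorem tendsto_apply_of_contractive (hB : ∀ n x, ‖B n x‖ ≤ ‖x‖) {x : ℕ → U} {a b : U}
    (hx : Tendsto x atTop (nhds a)) (hBa : Tendsto (fun n => B n a) atTop (nhds b)) :
    Tendsto (fun n => B n (x n)) atTop (nhds b) := by
  have h0 : Tendsto (fun n => B n (x n - a)) atTop (nhds 0) :=
    squeeze_zero_norm (fun n => hB n _) (tendsto_iff_norm_sub_tendsto_zero.1 hx)
  simpa using h0.add hBa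

theorem exists_tendsto_pow_apply (hB : ∀ n x, ‖B n x‖ ≤ ‖x‖)
    (hconv : ∀ g, ∃ l, Tendsto (fun n => B n g) atTop (nhds l)) (k : ℕ) {x : ℕ → U}
    (hx : ∃ l, Tendsto x atTop (nhds l)) :
    ∃ l, Tendsto (fun n => (B n ^ k) (x n)) atTop (nhds l) := by
  induction k with
  | zero => simpa using hx
  | succ k ih =>
    obtain ⟨a, ha⟩ := ih
    obtain ⟨b, hb⟩ := hconv a
    refine ⟨b, ?_⟩
    simp only [pow_succ', mul_apply_eq_comp]
    exact tendsto_apply_of_contractive hB ha hb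

variable [CompleteSpace U] {T : ℕ → U →L[ℝ] U} {J K : ℕ → U →L[ℝ] U} {τ σ : ℝ}

theorem exists_tendsto_resolvent_of_abs_lt (hσ : 0 < σ) (hτσ : |1 - τ / σ| < 1)
    (hJ : ∀ n : ℕ, IsContractiveResolvent (T n) (n * τ) (J n))
    (hK : ∀ n : ℕ, IsContractiveResolvent (T n) (n * σ) (K n))
    (hconv : ∀ g, ∃ l, Tendsto (fun n => J n g) atTop (nhds l)) (g : U) :
    ∃ l, Tendsto (fun n => K n g) atTop (nhds l) := by
  set c := τ / σ with hc
  have hfix : ∀ n, K n g = J n (c • g + (1 - c) • K n g) := by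
    intro n
    have h := (hJ n).apply_left (K n g)
    have h2 := (hK n).apply_right g
    have h3 : c • g + (1 - c) • K n g =
        K n g - ((n : ℝ) * τ) • (T n (K n g) - K n g) := by
      have : (n : ℝ) * τ = c * (n * σ) := by rw [hc]; field_simp
      nth_rewrite 1 [← h2]
      rw [this]
      module
    rw [h3, h]
  let y : ℕ → ℕ → U := fun i => Nat.rec (fun _ => 0)
    (fun _ z n => J n (c • g + (1 - c) • z n)) i
  have hy_conv : ∀ i, ∃ l, Tendsto (y i) atTop (nhds l) := by
    intro i
    induction i with
    | zero => exact ⟨0, tendsto_const_nhds⟩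
    | succ i ih =>
      obtain ⟨a, ha⟩ := ih
      obtain ⟨b, hb⟩ := hconv (c • g + (1 - c) • a)
      exact ⟨b, tendsto_apply_of_contractive (fun n => (hJ n).norm_apply_le)
        ((ha.const_smul (1 - c)).const_add (c • g)) hb⟩
  have hy_err : ∀ i n, ‖K n g - y i n‖ ≤ |1 - c| ^ i * ‖g‖ := by
    intro i
    induction i with
    | zero => intro n; simpa [y] using (hK n).norm_apply_le g
    | succ i ih =>
      intro n
      have h : K n g - y (i + 1) n = J n ((1 - c) • (K n g - y i n)) := by
        change K n g - J n (c • g + (1 - c) • y i n) = _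
        nth_rewrite 1 [hfix n]
        rw [← map_sub]
        congr 1
        module
      rw [h]
      refine ((hJ n).norm_apply_le _).trans ?_
      rw [norm_smul, Real.norm_eq_abs, pow_succ', mul_assoc]
      gcongr
      exact ih n
  refine exists_tendsto_of_approx fun ε hε => ?_
  have hlim : Tendsto (fun i => |1 - c| ^ i * ‖g‖) atTop (nhds 0) := by
    simpa using (tendsto_pow_atTop_nhds_zero_of_lt_one (abs_nonneg _) hτσ).mul_const ‖g‖
  obtain ⟨i, hi⟩ := (hlim.eventually (gt_mem_nhds hε)).exists
  exact ⟨y i, hy_conv i, Eventually.of_forall fun n => (hy_err i n).trans hi.le⟩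

theorem exists_tendsto_resolvent {J : ℝ → ℕ → U →L[ℝ] U}
    (hJ : ∀ τ > 0, ∀ n : ℕ, IsContractiveResolvent (T n) (n * τ) (J τ n)) (hτ : 0 < τ)
    (hconv : ∀ g, ∃ l, Tendsto (fun n => J τ n g) atTop (nhds l)) (hσ : 0 < σ) (g : U) :
    ∃ l, Tendsto (fun n => J σ n g) atTop (nhds l) := by
  have hstep : ∀ ρ > 0, ∀ σ > 0, ρ < 2 * σ →
      (∀ g, ∃ l, Tendsto (fun n => J ρ n g) atTop (nhds l)) →
      ∀ g, ∃ l, Tendsto (fun n => J σ n g) atTop (nhds l) := by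
    intro ρ hρ σ hσ hlt h
    refine exists_tendsto_resolvent_of_abs_lt hσ ?_ (hJ ρ hρ) (hJ σ hσ) h
    have h1 : ρ / σ < 2 := by rwa [div_lt_iff₀ hσ]
    have h2 : 0 < ρ / σ := by positivity
    rw [abs_lt]
    constructor <;> linarith
  have hall : ∀ k : ℕ, ∀ σ > 0, τ < 2 ^ k * σ →
      ∀ g, ∃ l, Tendsto (fun n => J σ n g) atTop (nhds l) := by
    intro k
    induction k with
    | zero =>
      intro σ hσ hlt
      exact hstep τ hτ σ hσ (by linarith) hconv
    | succ k ih =>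
      intro σ hσ hlt
      rw [pow_succ, mul_assoc, ← div_lt_iff₀' (by positivity)] at hlt
      obtain ⟨ρ, h1, h2⟩ := exists_between hlt
      have hρ : 0 < ρ := lt_trans (by positivity) h1
      exact hstep ρ hρ σ hσ h2 (ih ρ hρ (by rwa [div_lt_iff₀' (by positivity)] at h1))
  obtain ⟨k, hk⟩ := pow_unbounded_of_one_lt (τ / σ) (one_lt_two : (1 : ℝ) < 2)
  exact hall k σ hσ (by rwa [div_lt_iff₀ hσ] at hk) g

end StrongConvergence

section Generator

variable {U : Type*} [NormedAddCommGroup U] [NormedSpace ℝ U] {T J : ℕ → U →L[ℝ] U}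
  {D : Submodule ℝ U} {A : D →ₗ[ℝ] U} {τ : ℝ}

theorem tendsto_resolvent_sub_smul
    (hconv : ∀ f : D, Tendsto (fun n : ℕ => (n : ℝ) • (T n (f : U) - (f : U)))
      atTop (nhds (A f)))
    (hJ : ∀ n : ℕ, IsContractiveResolvent (T n) (n * τ) (J n)) (f : D) :
    Tendsto (fun n => J n ((f : U) - τ • A f)) atTop (nhds (f : U)) := by
  have h0 : Tendsto (fun n : ℕ => τ • ((n : ℝ) • (T n (f : U) - (f : U)) - A f))
      atTop (nhds 0) := by
    simpa using ((hconv f).sub_const (A f)).const_smul τ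
  have h1 := (tendsto_apply_of_contractive (fun n => (hJ n).norm_apply_le) h0
    (b := 0) (by simp)).add_const (f : U)
  rw [zero_add] at h1
  refine h1.congr fun n => ?_
  nth_rewrite 3 [← (hJ n).apply_left (f : U)]
  rw [← map_add]
  congr 1
  module

theorem exists_eventually_norm_resolvent_sub_le (hD : Dense (D : Set U))
    (hconv : ∀ f : D, Tendsto (fun n : ℕ => (n : ℝ) • (T n (f : U) - (f : U)))
      atTop (nhds (A f)))
    (hJ : ∀ n : ℕ, IsContractiveResolvent (T n) (n * τ) (J n)) (f : U) {ε : ℝ} (hε : 0 < ε) :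
    ∃ g, ∀ᶠ n in atTop, ‖J n g - f‖ ≤ ε := by
  obtain ⟨d, hd, hdist⟩ := hD.exists_dist_lt f hε
  refine ⟨d - τ • A ⟨d, hd⟩, ?_⟩
  have h := tendsto_resolvent_sub_smul hconv hJ ⟨d, hd⟩
  have h2 := (h.sub_const f).norm
  rw [dist_eq_norm, norm_sub_rev] at hdist
  filter_upwards [h2.eventually (gt_mem_nhds hdist)] with n hn using hn.le

theorem exists_tendsto_resolvent_of_dense_range [CompleteSpace U]
    (hconv : ∀ f : D, Tendsto (fun n : ℕ => (n : ℝ) • (T n (f : U) - (f : U)))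
      atTop (nhds (A f)))
    {lam : ℝ} (hlam : 0 < lam)
    (hrange : Dense (Set.range (fun f : D => lam • (f : U) - A f)))
    (hJ : ∀ n : ℕ, IsContractiveResolvent (T n) (n * lam⁻¹) (J n)) (g : U) :
    ∃ l, Tendsto (fun n => J n g) atTop (nhds l) := by
  refine exists_tendsto_of_approx fun ε hε => ?_
  obtain ⟨_, ⟨d, rfl⟩, hd⟩ := hrange.exists_dist_lt g hε
  refine ⟨fun n => J n (lam • (d : U) - A d), ⟨lam • (d : U), ?_⟩, ?_⟩
  · refine ((tendsto_resolvent_sub_smul hconv hJ d).const_smul lam).congr fun n => ?_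
    rw [← map_smul, smul_sub, smul_smul, mul_inv_cancel₀ hlam.ne', one_smul]
  · refine Eventually.of_forall fun n => ?_
    rw [← map_sub]
    rw [dist_eq_norm] at hd
    exact ((hJ n).norm_apply_le _).trans hd.le

theorem exists_tendsto_pow_floor_apply [CompleteSpace U] (hT : ∀ n, ‖T n‖ ≤ 1)
    (hD : Dense (D : Set U))
    (hconv : ∀ f : D, Tendsto (fun n : ℕ => (n : ℝ) • (T n (f : U) - (f : U)))
      atTop (nhds (A f)))
    {lam : ℝ} (hlam : 0 < lam)
    (hrange : Dense (Set.range (fun f : D => lam • (f : U) - A f))) (t : ℝ) (f : U) :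
    ∃ l, Tendsto (fun n : ℕ => ((T n) ^ ⌊(n : ℝ) * t⌋₊) f) atTop (nhds l) := by
  have hT' : ∀ n x, ‖T n x‖ ≤ ‖x‖ := fun n x => by simpa using (T n).le_of_opNorm_le (hT n) x
  rcases le_or_gt t 0 with ht | ht
  · refine ⟨f, tendsto_const_nhds.congr fun n => ?_⟩
    rw [Nat.floor_of_nonpos (mul_nonpos_of_nonneg_of_nonpos n.cast_nonneg ht)]
    simp
  have hex : ∀ (τ : ℝ) (n : ℕ), ∃ J, 0 < τ → IsContractiveResolvent (T n) (n * τ) J := by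
    intro τ n
    by_cases hτ : 0 < τ
    · obtain ⟨J, hJ⟩ := exists_isContractiveResolvent (hT n) (s := n * τ) (by positivity)
      exact ⟨J, fun _ => hJ⟩
    · exact ⟨0, fun h => absurd h hτ⟩
  choose J hJ using hex
  replace hJ : ∀ τ > 0, ∀ n : ℕ, IsContractiveResolvent (T n) (n * τ) (J τ n) :=
    fun τ hτ n => hJ τ n hτ
  set τ₀ := lam⁻¹ with hτ₀_def
  have hτ₀ : 0 < τ₀ := inv_pos.2 hlam
  have hJ₀conv := exists_tendsto_resolvent_of_dense_range hconv hlam hrange (hJ τ₀ hτ₀)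
  have hsmooth : ∀ g, ∃ l, Tendsto
      (fun n : ℕ => ((T n) ^ ⌊(n : ℝ) * t⌋₊) (J τ₀ n (J τ₀ n g))) atTop (nhds l) := by
    intro g
    refine exists_tendsto_of_approx fun ε hε => ?_
    obtain ⟨k, hk⟩ := exists_nat_gt (8 * (t / τ₀) ^ 2 * ‖g‖ / (ε / 2))
    have hk0 : (0 : ℝ) < k := lt_of_le_of_lt (by positivity) hk
    have htk : 0 < t / k := by positivity
    refine ⟨fun n => (J (t / k) n ^ k) (J τ₀ n (J τ₀ n g)), ?_, ?_⟩
    · refine exists_tendsto_pow_apply (fun n => (hJ _ htk n).norm_apply_le)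
        (exists_tendsto_resolvent hJ hτ₀ hJ₀conv htk) k ?_
      simpa [pow_succ] using exists_tendsto_pow_apply (fun n => (hJ _ hτ₀ n).norm_apply_le)
        hJ₀conv 2 (x := fun _ => g) ⟨g, tendsto_const_nhds⟩
    · have hlim : Tendsto (fun n : ℕ => (4 * k * ‖g‖ / τ₀) / (n : ℝ)) atTop (nhds 0) :=
        tendsto_const_div_atTop_nhds_zero_nat _
      filter_upwards [hlim.eventually (gt_mem_nhds (half_pos hε)), eventually_gt_atTop 0]
        with n hn hn0
      have hn0' : (0 : ℝ) < n := by exact_mod_cast hn0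
      have h := (hJ _ htk n).norm_pow_floor_apply_sub_le_of_smoothed (hJ _ hτ₀ n) (hT' n)
        (by positivity) (by positivity) k g
      have h1 : (k : ℝ) * (n * (t / k)) = n * t := by field_simp
      have h2 : 8 * k * ((n * (t / k)) / (n * τ₀)) ^ 2 * ‖g‖ = 8 * (t / τ₀) ^ 2 * ‖g‖ / k := by
        field_simp
      have h3 : 4 * k * ‖g‖ / (n * τ₀) = (4 * k * ‖g‖ / τ₀) / (n : ℝ) := by
        field_simp
      rw [h1, h2, h3] at h
      have h4 : 8 * (t / τ₀) ^ 2 * ‖g‖ / k < ε / 2 := by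
        rw [div_lt_iff₀ (by positivity)] at hk ⊢
        linarith
      linarith
  refine exists_tendsto_of_approx fun ε hε => ?_
  obtain ⟨g₁, hg₁⟩ :=
    exists_eventually_norm_resolvent_sub_le hD hconv (hJ τ₀ hτ₀) f (half_pos hε)
  obtain ⟨g₂, hg₂⟩ :=
    exists_eventually_norm_resolvent_sub_le hD hconv (hJ τ₀ hτ₀) g₁ (half_pos hε)
  refine ⟨_, hsmooth g₂, ?_⟩
  filter_upwards [hg₁, hg₂] with n h1 h2
  rw [← map_sub]
  refine (norm_pow_apply_le (hT' n) _ _).trans ?_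
  have h3 := (hJ τ₀ hτ₀ n).norm_apply_le (J τ₀ n g₂ - g₁)
  rw [map_sub] at h3
  rw [norm_sub_rev]
  linarith [norm_sub_le_norm_sub_add_norm_sub (J τ₀ n (J τ₀ n g₂)) (J τ₀ n g₁) f]

end Generator

/-- **Trotter's approximation theorem (contraction case).**  Let `U` be a real Banach space and
`(Tₙ)` contractions on `U`.  Let `D ⊆ U` be a dense subspace and `A : D → U` linear with
`n(Tₙ f − f) → A f` for every `f ∈ D`.  If for some `λ > 0` the range of `λ − A` is dense in
`U`, then there is a contraction `C₀`-semigroup `(S_t)_{t ≥ 0}` on `U` such that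
`Tₙ^{⌊nt⌋} f → S_t f` for every `t ≥ 0` and `f ∈ U`. -/
theorem trotter_approximation (U : Type*) [NormedAddCommGroup U] [NormedSpace ℝ U]
    [CompleteSpace U]
    (T : ℕ → U →L[ℝ] U) (hT : ∀ n, ‖T n‖ ≤ 1)
    (D : Submodule ℝ U) (hD : Dense (D : Set U))
    (A : D →ₗ[ℝ] U)
    (hconv : ∀ f : D, Tendsto (fun n : ℕ => (n : ℝ) • (T n (f : U) - (f : U)))
      atTop (nhds (A f)))
    (lam : ℝ) (hlam : 0 < lam)
    (hrange : Dense (Set.range (fun f : D => lam • (f : U) - A f))) :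
    ∃ S : ℝ → U →L[ℝ] U,
      S 0 = ContinuousLinearMap.id ℝ U ∧
      (∀ s ≥ (0 : ℝ), ∀ t ≥ (0 : ℝ), S (t + s) = (S t).comp (S s)) ∧
      (∀ t ≥ (0 : ℝ), ‖S t‖ ≤ 1) ∧
      (∀ f : U, ContinuousOn (fun t => S t f) (Set.Ici 0)) ∧
      (∀ t ≥ (0 : ℝ), ∀ f : U,
        Tendsto (fun n : ℕ => ((T n) ^ ⌊(n : ℝ) * t⌋₊) f) atTop (nhds (S t f))) := by
  have hT' : ∀ n x, ‖T n x‖ ≤ ‖x‖ := fun n x => by simpa using (T n).le_of_opNorm_le (hT n) x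
  choose L hL using exists_tendsto_pow_floor_apply hT hD hconv hlam hrange
  have hL_norm : ∀ t f, ‖L t f‖ ≤ ‖f‖ := fun t f =>
    le_of_tendsto' (hL t f).norm fun n => norm_pow_apply_le (hT' n) _ f
  let S : ℝ → U →L[ℝ] U := fun t => LinearMap.mkContinuous
    { toFun := L t
      map_add' := fun f g => tendsto_nhds_unique (hL t (f + g)) <| by
        simpa using (hL t f).add (hL t g)
      map_smul' := fun c f => tendsto_nhds_unique (hL t (c • f)) <| by
        simpa using (hL t f).const_smul c } 1 fun f => by simpa using hL_norm t f
  have hS : ∀ t f, Tendsto (fun n : ℕ => ((T n) ^ ⌊(n : ℝ) * t⌋₊) f) atTop (nhds (S t f)) := hL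
  have hone : ∀ f, Tendsto (fun n => T n f - f) atTop (nhds 0) := by
    have hDone : ∀ f : D, Tendsto (fun n => T n (f : U)) atTop (nhds (f : U)) := by
      intro f
      have h := ((tendsto_inv_atTop_nhds_zero_nat (𝕜 := ℝ)).smul
        (hconv f)).add_const (f : U)
      rw [zero_smul, zero_add] at h
      refine h.congr' ?_
      filter_upwards [eventually_gt_atTop 0] with n hn
      have : (n : ℝ) ≠ 0 := by positivity
      simp [smul_smul, this]
    intro f
    rw [Metric.tendsto_nhds]
    intro ε hε
    obtain ⟨d, hd, hfd⟩ := hD.exists_dist_lt f (show 0 < ε / 3 by positivity)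
    have h := (Metric.tendsto_nhds.1 (hDone ⟨d, hd⟩)) (ε / 3) (by positivity)
    filter_upwards [h] with n hn
    rw [dist_eq_norm] at hn hfd
    have h1 : T n f - f - 0 = T n (f - d) + (T n d - d) - (f - d) := by
      rw [map_sub]; abel
    rw [dist_eq_norm, h1]
    linarith [norm_sub_le (T n (f - d) + (T n d - d)) (f - d),
      norm_add_le (T n (f - d)) (T n d - d), hT' n (f - d)]
  refine ⟨S, ?_, ?_, ?_, ?_, fun t _ => hS t⟩
  · ext f
    exact tendsto_nhds_unique (hS 0 f) (by simp)
  · intro s hs t ht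
    ext f
    refine tendsto_nhds_unique (hS (t + s) f) ?_
    have hcomp : Tendsto (fun n : ℕ => (T n ^ ⌊(n : ℝ) * t⌋₊) ((T n ^ ⌊(n : ℝ) * s⌋₊) f))
        atTop (nhds (S t (S s f))) :=
      tendsto_apply_of_contractive (fun n => norm_pow_apply_le (hT' n) _) (hS s f) (hS t _)
    have hdiff : Tendsto (fun n : ℕ => (T n ^ ⌊(n : ℝ) * (t + s)⌋₊) f -
        (T n ^ ⌊(n : ℝ) * t⌋₊) ((T n ^ ⌊(n : ℝ) * s⌋₊) f)) atTop (nhds 0) := by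
      refine squeeze_zero_norm (fun n => ?_) (by simpa using ((hone f).norm.const_mul 2))
      rw [← mul_apply_eq_comp, ← pow_add]
      refine (norm_pow_apply_sub_pow_apply_le (hT' n) _ _ f).trans ?_
      gcongr
      have hnt : 0 ≤ (n : ℝ) * t := by positivity
      have hns : 0 ≤ (n : ℝ) * s := by positivity
      have h1 := Nat.floor_le hnt
      have h2 := Nat.floor_le hns
      have h3 := Nat.floor_le (show 0 ≤ (n : ℝ) * (t + s) by positivity)
      have h4 := Nat.lt_floor_add_one ((n : ℝ) * t)
      have h5 := Nat.lt_floor_add_one ((n : ℝ) * s)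
      have h6 := Nat.lt_floor_add_one ((n : ℝ) * (t + s))
      push_cast
      rw [abs_le]
      constructor <;> linarith
    simpa using hdiff.add hcomp
  · intro t _
    exact LinearMap.mkContinuous_norm_le _ zero_le_one _
  · have hlip : ∀ d : D, ∀ s ≥ (0 : ℝ), ∀ t ≥ (0 : ℝ),
        ‖S t d - S s d‖ ≤ |t - s| * ‖A d‖ := by
      intro d s hs t ht
      have hlim : Tendsto (fun n : ℕ => |(⌊t * (n : ℝ)⌋₊ : ℝ) / n - (⌊s * (n : ℝ)⌋₊ : ℝ) / n| *
          ‖(n : ℝ) • (T n (d : U) - d)‖) atTop (nhds (|t - s| * ‖A d‖)) :=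
        ((((tendsto_nat_floor_mul_div_atTop ht).comp tendsto_natCast_atTop_atTop).sub
          ((tendsto_nat_floor_mul_div_atTop hs).comp tendsto_natCast_atTop_atTop)).abs).mul
          (hconv d).norm
      refine le_of_tendsto_of_tendsto ((hS t d).sub (hS s d)).norm hlim ?_
      filter_upwards [eventually_gt_atTop 0] with n hn
      have hn' : (0 : ℝ) < n := by exact_mod_cast hn
      refine (norm_pow_apply_sub_pow_apply_le (hT' n) _ _ _).trans_eq ?_
      rw [norm_smul, Real.norm_of_nonneg hn'.le, ← sub_div, abs_div, abs_of_pos hn',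
        mul_comm (n : ℝ) t, mul_comm (n : ℝ) s]
      field_simp
    intro f
    refine continuousOn_of_uniform_approx_of_continuousOn fun u hu => ?_
    obtain ⟨ε, hε, hεu⟩ := Metric.mem_uniformity_dist.1 hu
    obtain ⟨d, hd, hfd⟩ := hD.exists_dist_lt f hε
    refine ⟨fun t => S t d, ?_, fun t _ => hεu ?_⟩
    · refine LipschitzOnWith.continuousOn (K := ‖A ⟨d, hd⟩‖₊) ?_
      refine LipschitzOnWith.of_dist_le_mul fun t ht s hs => ?_
      rw [dist_eq_norm, Real.dist_eq, mul_comm]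
      exact hlip ⟨d, hd⟩ s hs t ht
    · rw [dist_eq_norm] at hfd ⊢
      rw [← map_sub]
      exact (hL_norm t _).trans_lt hfd
end

section
/- Let e₀(x) = 1, e₁(x) = x, e₂(x) = x² on [0,1]. If (Lₙ)_{n≥1} is a sequence of positive linear operators on C([0,1]) (i.e., Lₙf ≥ 0 pointwise whenever f ≥ 0 pointwise) such that lim_{n→∞} ‖Lₙeᵢ − eᵢ‖_∞ = 0 for i = 0, 1, 2, then lim_{n→∞} ‖Lₙf − f‖_∞ = 0 for every f ∈ C([0,1]). -/
open Filter

/-- A continuous function on a compact metric space has increments bounded by an arbitrarily small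
constant plus a multiple of the squared distance. -/
theorem ContinuousMap.exists_abs_sub_le_add_mul_dist_sq {X : Type*} [PseudoMetricSpace X]
    [CompactSpace X] (f : C(X, ℝ)) {ε : ℝ} (hε : 0 < ε) :
    ∃ C : ℝ, 0 ≤ C ∧ ∀ x y, |f x - f y| ≤ ε + C * dist x y ^ 2 := by
  obtain ⟨δ, hδ, hf⟩ := Metric.uniformContinuous_iff.1
    (CompactSpace.uniformContinuous_of_continuous f.continuous) ε hε
  refine ⟨2 * ‖f‖ / δ ^ 2, by positivity, fun x y => ?_⟩
  rcases lt_or_ge (dist x y) δ with h | h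
  · have h_lt : |f x - f y| < ε := hf h
    have h_nonneg : 0 ≤ 2 * ‖f‖ / δ ^ 2 * dist x y ^ 2 := by positivity
    linarith
  · have h_le : |f x - f y| ≤ 2 * ‖f‖ := by
      simpa [Real.dist_eq] using f.dist_le_two_norm x y
    have h_one : 1 ≤ dist x y ^ 2 / δ ^ 2 := (one_le_div (by positivity)).2 (by gcongr)
    calc |f x - f y| ≤ 2 * ‖f‖ * 1 := by linarith
      _ ≤ 2 * ‖f‖ * (dist x y ^ 2 / δ ^ 2) := by gcongr
      _ = 2 * ‖f‖ / δ ^ 2 * dist x y ^ 2 := by ring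
      _ ≤ _ := by linarith

/-- A positive linear functional preserves domination of the absolute value. -/
theorem abs_map_le_map_of_abs_le {X : Type*} [TopologicalSpace X] (φ : C(X, ℝ) →ₗ[ℝ] ℝ)
    (hφ : ∀ f : C(X, ℝ), (∀ x, 0 ≤ f x) → 0 ≤ φ f) {f g : C(X, ℝ)} (h : ∀ x, |f x| ≤ g x) :
    |φ f| ≤ φ g := by
  have h_sub := hφ (g - f) fun x => sub_nonneg.2 (abs_le.1 (h x)).2
  have h_add := hφ (g + f) fun x => by
    have := (abs_le.1 (h x)).1
    simp only [ContinuousMap.add_apply]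
    linarith
  rw [map_sub] at h_sub
  rw [map_add] at h_add
  exact abs_le.2 ⟨by linarith, by linarith⟩

/-- Quantitative form of Korovkin's theorem: the error on `f` is controlled by the errors on
`1`, `x` and `x ^ 2`. -/
theorem norm_map_sub_le_of_abs_sub_le
    (T : C(Set.Icc (0 : ℝ) 1, ℝ) →ₗ[ℝ] C(Set.Icc (0 : ℝ) 1, ℝ))
    (hT : ∀ f : C(Set.Icc (0 : ℝ) 1, ℝ), (∀ x, 0 ≤ f x) → ∀ x, 0 ≤ (T f) x)
    {e₀ e₁ e₂ : C(Set.Icc (0 : ℝ) 1, ℝ)}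
    (he₀ : ∀ x, e₀ x = 1) (he₁ : ∀ x, e₁ x = (x : ℝ)) (he₂ : ∀ x, e₂ x = (x : ℝ) ^ 2)
    {f : C(Set.Icc (0 : ℝ) 1, ℝ)} {ε C : ℝ} (hε : 0 ≤ ε) (hC : 0 ≤ C)
    (hf : ∀ x y, |f x - f y| ≤ ε + C * dist x y ^ 2) :
    ‖T f - f‖ ≤ ε + (ε + C + ‖f‖) * ‖T e₀ - e₀‖ + 2 * C * ‖T e₁ - e₁‖
      + C * ‖T e₂ - e₂‖ := by
  refine (ContinuousMap.norm_le _ (by positivity)).2 fun x => ?_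
  have h_dom := abs_map_le_map_of_abs_le
    ((ContinuousMap.evalCLM ℝ x : C(Set.Icc (0 : ℝ) 1, ℝ) →L[ℝ] ℝ).toLinearMap ∘ₗ T)
    (fun g hg => hT g hg x) (f := f - f x • e₀)
    (g := ε • e₀ + C • (e₂ - (2 * (x : ℝ)) • e₁ + ((x : ℝ) ^ 2) • e₀)) fun t => by
      have h := hf t x
      rw [Subtype.dist_eq, Real.dist_eq, sq_abs] at h
      simp only [ContinuousMap.sub_apply, ContinuousMap.add_apply, ContinuousMap.smul_apply,
        smul_eq_mul, he₀, he₁, he₂, mul_one]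
      exact h.trans_eq (by ring)
  have h_val : |T f x - f x * T e₀ x| ≤
      ε * T e₀ x + C * (T e₂ x - 2 * x * T e₁ x + (x : ℝ) ^ 2 * T e₀ x) := by
    simpa [mul_add] using h_dom
  have h₀ : |T e₀ x - 1| ≤ ‖T e₀ - e₀‖ := by
    simpa [he₀] using (T e₀ - e₀).norm_coe_le_norm x
  have h₁ : |T e₁ x - x| ≤ ‖T e₁ - e₁‖ := by
    simpa [he₁] using (T e₁ - e₁).norm_coe_le_norm x
  have h₂ : |T e₂ x - (x : ℝ) ^ 2| ≤ ‖T e₂ - e₂‖ := by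
    simpa [he₂] using (T e₂ - e₂).norm_coe_le_norm x
  have hfx : |f x| ≤ ‖f‖ := f.norm_coe_le_norm x
  obtain ⟨hx₀, hx₁⟩ := x.2
  have h_sq : (x : ℝ) ^ 2 * (T e₀ x - 1) ≤ ‖T e₀ - e₀‖ :=
    calc (x : ℝ) ^ 2 * (T e₀ x - 1) ≤ (x : ℝ) ^ 2 * ‖T e₀ - e₀‖ := by
          gcongr
          exact (le_abs_self _).trans h₀
      _ ≤ 1 * ‖T e₀ - e₀‖ := by
          gcongr
          exact pow_le_one₀ hx₀ hx₁
      _ = _ := one_mul _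
  have h_lin : x * (x - T e₁ x) ≤ ‖T e₁ - e₁‖ :=
    calc x * (x - T e₁ x) ≤ x * ‖T e₁ - e₁‖ := by
          gcongr
          linarith [neg_abs_le (T e₁ x - x)]
      _ ≤ 1 * ‖T e₁ - e₁‖ := by gcongr
      _ = _ := one_mul _
  have h_second : T e₂ x - 2 * x * T e₁ x + (x : ℝ) ^ 2 * T e₀ x ≤
      ‖T e₂ - e₂‖ + 2 * ‖T e₁ - e₁‖ + ‖T e₀ - e₀‖ := by
    linarith [le_abs_self (T e₂ x - (x : ℝ) ^ 2)]
  have h_zeroth : T e₀ x ≤ 1 + ‖T e₀ - e₀‖ := by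
    linarith [le_abs_self (T e₀ x - 1)]
  calc |T f x - f x| = |(T f x - f x * T e₀ x) + f x * (T e₀ x - 1)| := by ring_nf
    _ ≤ |T f x - f x * T e₀ x| + |f x| * |T e₀ x - 1| := by
        rw [← abs_mul]
        exact abs_add_le _ _
    _ ≤ (ε * (1 + ‖T e₀ - e₀‖) + C * (‖T e₂ - e₂‖ + 2 * ‖T e₁ - e₁‖ + ‖T e₀ - e₀‖))
          + ‖f‖ * ‖T e₀ - e₀‖ := by
        gcongr
        exact h_val.trans (by gcongr)
    _ = _ := by ring

/-- **Korovkin's first theorem.**  Let `e₀ = 1`, `e₁ = x`, `e₂ = x²` on `[0,1]`.  If `(Lₙ)` is a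
sequence of positive linear operators on `C([0,1])` with `‖Lₙ eᵢ − eᵢ‖_∞ → 0` for `i = 0,1,2`,
then `‖Lₙ f − f‖_∞ → 0` for every `f ∈ C([0,1])`. -/
theorem korovkin_first
    (L : ℕ → C(Set.Icc (0 : ℝ) 1, ℝ) →ₗ[ℝ] C(Set.Icc (0 : ℝ) 1, ℝ))
    (hpos : ∀ n : ℕ, ∀ f : C(Set.Icc (0 : ℝ) 1, ℝ),
      (∀ x, 0 ≤ f x) → ∀ x, 0 ≤ (L n f) x)
    (e₀ e₁ e₂ : C(Set.Icc (0 : ℝ) 1, ℝ))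
    (he₀ : ∀ x, e₀ x = 1) (he₁ : ∀ x, e₁ x = (x : ℝ)) (he₂ : ∀ x, e₂ x = (x : ℝ) ^ 2)
    (h0 : Tendsto (fun n => ‖L n e₀ - e₀‖) atTop (nhds 0))
    (h1 : Tendsto (fun n => ‖L n e₁ - e₁‖) atTop (nhds 0))
    (h2 : Tendsto (fun n => ‖L n e₂ - e₂‖) atTop (nhds 0)) :
    ∀ f : C(Set.Icc (0 : ℝ) 1, ℝ), Tendsto (fun n => ‖L n f - f‖) atTop (nhds 0) := by
  intro f
  refine tendsto_order.2 ⟨fun a ha => .of_forall fun n => ha.trans_le (norm_nonneg _),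
    fun a ha => ?_⟩
  obtain ⟨C, hC, hf⟩ := f.exists_abs_sub_le_add_mul_dist_sq (half_pos ha)
  have h_lim := (((h0.const_mul (a / 2 + C + ‖f‖)).const_add (a / 2)).add
    (h1.const_mul (2 * C))).add (h2.const_mul C)
  simp only [mul_zero, add_zero] at h_lim
  filter_upwards [h_lim.eventually_lt_const (half_lt_self ha)] with n hn
  exact (norm_map_sub_le_of_abs_sub_le (L n) (hpos n) he₀ he₁ he₂ (half_pos ha).le hC hf).trans_lt
    hn
end

section
/- Let 0 < λ₁ < λ₂ < λ₃ and set f_{λ}(x) = e^{−λx} for x ∈ [0,∞). Let (Lₙ)_{n≥1} be a sequence of positive bounded linear operators on C_∞([0,∞)) (i.e., Lₙf ≥ 0 pointwise whenever f ≥ 0 pointwise) with sup_{n≥1} ‖Lₙ‖ < ∞, such that lim_{n→∞} ‖Lₙf_{λ_k} − f_{λ_k}‖_∞ = 0 for k = 1, 2, 3. Then lim_{n→∞} ‖Lₙf − f‖_∞ = 0 for every f ∈ C_∞([0,∞)). -/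
open Filter

/-- Membership in `C_∞([0,∞))`: continuous on `[0,∞)` and vanishing at infinity. -/
def CInfty (f : ℝ → ℝ) : Prop :=
  ContinuousOn f (Set.Ici 0) ∧ Tendsto f atTop (nhds 0)

lemma CInfty.add {f g : ℝ → ℝ} (hf : CInfty f) (hg : CInfty g) : CInfty (f + g) :=
  ⟨hf.1.add hg.1, by simpa [Pi.add_def] using hf.2.add hg.2⟩

lemma CInfty.smul {f : ℝ → ℝ} (hf : CInfty f) (c : ℝ) : CInfty (c • f) :=
  ⟨hf.1.const_smul c, by simpa [Pi.smul_def] using hf.2.const_mul c⟩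

lemma cInfty_exp_neg_mul {a : ℝ} (ha : 0 < a) : CInfty (fun y => Real.exp (-a * y)) := by
  refine ⟨by fun_prop, Real.tendsto_exp_atBot.comp ?_⟩
  exact tendsto_id.const_mul_atTop_of_neg (by linarith)

/-- A map on functions that is linear and positive on `C_∞([0,∞))`. -/
structure IsPosLinear (T : (ℝ → ℝ) → (ℝ → ℝ)) : Prop where
  add : ∀ f g, CInfty f → CInfty g → ∀ x ≥ (0 : ℝ), T (f + g) x = T f x + T g x
  smul : ∀ (c : ℝ) f, CInfty f → ∀ x ≥ (0 : ℝ), T (c • f) x = c * T f x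
  nonneg : ∀ f, CInfty f → (∀ x ≥ (0 : ℝ), 0 ≤ f x) → ∀ x ≥ (0 : ℝ), 0 ≤ T f x

namespace IsPosLinear

variable {T : (ℝ → ℝ) → (ℝ → ℝ)}

lemma add_smul (hT : IsPosLinear T) {f g : ℝ → ℝ} (hf : CInfty f) (hg : CInfty g) (c : ℝ)
    {x : ℝ} (hx : 0 ≤ x) : T (f + c • g) x = T f x + c * T g x := by
  rw [hT.add _ _ hf (hg.smul c) x hx, hT.smul c g hg x hx]

lemma abs_le (hT : IsPosLinear T) {u v : ℝ → ℝ} (hu : CInfty u) (hv : CInfty v)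
    (huv : ∀ t ≥ (0 : ℝ), |u t| ≤ v t) {x : ℝ} (hx : 0 ≤ x) : |T u x| ≤ T v x := by
  have h1 := hT.nonneg (v + (1 : ℝ) • u) (hv.add (hu.smul 1))
    (fun t ht => by
      have := (_root_.abs_le.1 (huv t ht)).1
      simp only [Pi.add_apply, Pi.smul_apply, smul_eq_mul]; linarith) x hx
  have h2 := hT.nonneg (v + (-1 : ℝ) • u) (hv.add (hu.smul (-1)))
    (fun t ht => by
      have := (_root_.abs_le.1 (huv t ht)).2
      simp only [Pi.add_apply, Pi.smul_apply, smul_eq_mul]; linarith) x hx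
  rw [hT.add_smul hv hu _ hx] at h1 h2
  rw [_root_.abs_le]
  constructor <;> linarith

end IsPosLinear

/-- A combination of `1`, `e^{-μs}`, `e^{-νs}` with a double zero at `0`. -/
noncomputable def expBump (μ ν s : ℝ) : ℝ :=
  (ν - μ) - ν * Real.exp (-μ * s) + μ * Real.exp (-ν * s)

lemma expBump_zero (μ ν : ℝ) : expBump μ ν 0 = 0 := by simp [expBump]

lemma continuous_expBump (μ ν : ℝ) : Continuous (expBump μ ν) := by
  unfold expBump; fun_prop

lemma hasDerivAt_expBump (μ ν s : ℝ) :
    HasDerivAt (expBump μ ν) (μ * ν * (Real.exp (-μ * s) - Real.exp (-ν * s))) s := by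
  have h (a : ℝ) : HasDerivAt (fun y => Real.exp (-a * y)) (Real.exp (-a * s) * (-a * 1)) s :=
    ((hasDerivAt_id s).const_mul (-a)).exp
  have := (((h μ).const_mul ν).const_sub (ν - μ)).add ((h ν).const_mul μ)
  exact this.congr_deriv (by ring)

lemma strictMonoOn_expBump {μ ν : ℝ} (hμ : 0 < μ) (hμν : μ < ν) :
    StrictMonoOn (expBump μ ν) (Set.Ici 0) := by
  refine strictMonoOn_of_deriv_pos (convex_Ici 0) (continuous_expBump μ ν).continuousOn ?_
  intro s hs
  rw [interior_Ici, Set.mem_Ioi] at hs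
  rw [(hasDerivAt_expBump μ ν s).deriv]
  have : Real.exp (-ν * s) < Real.exp (-μ * s) := Real.exp_lt_exp.2 (by nlinarith)
  exact mul_pos (mul_pos hμ (hμ.trans hμν)) (by linarith)

lemma strictAntiOn_expBump {μ ν : ℝ} (hμ : 0 < μ) (hμν : μ < ν) :
    StrictAntiOn (expBump μ ν) (Set.Iic 0) := by
  refine strictAntiOn_of_deriv_neg (convex_Iic 0) (continuous_expBump μ ν).continuousOn ?_
  intro s hs
  rw [interior_Iic, Set.mem_Iio] at hs
  rw [(hasDerivAt_expBump μ ν s).deriv]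
  have : Real.exp (-μ * s) < Real.exp (-ν * s) := Real.exp_lt_exp.2 (by nlinarith)
  exact mul_neg_of_pos_of_neg (mul_pos hμ (hμ.trans hμν)) (by linarith)

lemma expBump_nonneg {μ ν : ℝ} (hμ : 0 < μ) (hμν : μ < ν) (s : ℝ) : 0 ≤ expBump μ ν s := by
  rw [← expBump_zero μ ν]
  rcases le_total 0 s with hs | hs
  · exact (strictMonoOn_expBump hμ hμν).monotoneOn Set.self_mem_Ici hs hs
  · exact (strictAntiOn_expBump hμ hμν).antitoneOn hs Set.self_mem_Iic hs

lemma exists_pos_le_expBump {μ ν δ : ℝ} (hμ : 0 < μ) (hμν : μ < ν) (hδ : 0 < δ) :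
    ∃ m > 0, ∀ s, δ ≤ |s| → m ≤ expBump μ ν s := by
  have hδ' : -δ ≤ 0 := by linarith
  refine ⟨min (expBump μ ν δ) (expBump μ ν (-δ)), lt_min ?_ ?_, fun s hs => ?_⟩
  · rw [← expBump_zero μ ν]
    exact strictMonoOn_expBump hμ hμν Set.self_mem_Ici hδ.le hδ
  · rw [← expBump_zero μ ν]
    exact strictAntiOn_expBump hμ hμν hδ' Set.self_mem_Iic (by linarith)
  · rcases le_abs.1 hs with h | h
    · exact (min_le_left _ _).trans
        ((strictMonoOn_expBump hμ hμν).monotoneOn hδ.le (hδ.le.trans h) h)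
    · have h' : s ≤ -δ := by linarith
      exact (min_le_right _ _).trans
        ((strictAntiOn_expBump hμ hμν).antitoneOn (h'.trans hδ') hδ' h')

/-- A bounded continuous function has oscillation around points of `[0,R]` controlled by
`expBump`, uniformly. -/
lemma exists_abs_sub_le_expBump {μ ν : ℝ} (hμ : 0 < μ) (hμν : μ < ν) {φ : ℝ → ℝ}
    (hφ : ContinuousOn φ (Set.Ici 0)) {M : ℝ} (hM : ∀ t ≥ (0 : ℝ), |φ t| ≤ M) (R : ℝ)
    {ε : ℝ} (hε : 0 < ε) :
    ∃ K ≥ (0 : ℝ), ∀ x ∈ Set.Icc 0 R, ∀ t ≥ (0 : ℝ),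
      |φ t - φ x| ≤ ε + K * expBump μ ν (t - x) := by
  have huc : UniformContinuousOn φ (Set.Icc 0 (R + 1)) :=
    isCompact_Icc.uniformContinuousOn_of_continuous (hφ.mono Set.Icc_subset_Ici_self)
  obtain ⟨δ, hδ, hδε⟩ := Metric.uniformContinuousOn_iff.1 huc ε hε
  obtain ⟨m, hm, hmle⟩ := exists_pos_le_expBump hμ hμν (lt_min hδ one_pos)
  have hM0 : 0 ≤ M := (abs_nonneg _).trans (hM 0 le_rfl)
  refine ⟨2 * M / m, by positivity, fun x hx t ht => ?_⟩
  rcases lt_or_ge |t - x| (min δ 1) with h | h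
  · have h1 := (abs_lt.1 (h.trans_le (min_le_right _ _))).2
    have := hδε t ⟨ht, by linarith [hx.2]⟩ x ⟨hx.1, by linarith [hx.2]⟩
      (by rw [Real.dist_eq]; exact h.trans_le (min_le_left _ _))
    rw [Real.dist_eq] at this
    have := mul_nonneg (show 0 ≤ 2 * M / m by positivity) (expBump_nonneg hμ hμν (t - x))
    linarith
  · have h1 : 2 * M / m * m ≤ 2 * M / m * expBump μ ν (t - x) :=
      mul_le_mul_of_nonneg_left (hmle _ h) (by positivity)
    rw [div_mul_cancel₀ _ hm.ne'] at h1
    have := abs_sub (φ t) (φ x)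
    linarith [hM t ht, hM x hx.1]

/-- Pointwise Korovkin estimate for functions of the form `e^{-at} φ(t)`. -/
lemma IsPosLinear.abs_sub_le {T : (ℝ → ℝ) → (ℝ → ℝ)} (hT : IsPosLinear T) {a b c : ℝ}
    (ha : 0 < a) (hab : a < b) (hbc : b < c) {g φ : ℝ → ℝ} (hg : CInfty g)
    (hgφ : ∀ t ≥ (0 : ℝ), g t = φ t * Real.exp (-a * t)) {ε K M R τ x : ℝ} (hε : 0 ≤ ε)
    (hK : 0 ≤ K) (hx : x ∈ Set.Icc 0 R) (hM : |φ x| ≤ M)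
    (hφ : ∀ t ≥ (0 : ℝ), |φ t - φ x| ≤ ε + K * expBump (b - a) (c - a) (t - x))
    (hτ : ∀ l, (l = a ∨ l = b ∨ l = c) →
      |T (fun y => Real.exp (-l * y)) x - Real.exp (-l * x)| ≤ τ) :
    |T g x - g x| ≤ ε + τ * (ε + M + K * ((c - b) + (c - a) * Real.exp ((b - a) * R) +
      (b - a) * Real.exp ((c - a) * R))) := by
  set e : ℝ → ℝ → ℝ := fun l y => Real.exp (-l * y) with he
  have hea : CInfty (e a) := cInfty_exp_neg_mul ha
  have heb : CInfty (e b) := cInfty_exp_neg_mul (ha.trans hab)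
  have hec : CInfty (e c) := cInfty_exp_neg_mul (ha.trans (hab.trans hbc))
  have hx0 := hx.1
  set p := Real.exp ((b - a) * x) with hp
  set q := Real.exp ((c - a) * x) with hq
  have hpR : p ≤ Real.exp ((b - a) * R) :=
    Real.exp_le_exp.2 (mul_le_mul_of_nonneg_left hx.2 (by linarith))
  have hqR : q ≤ Real.exp ((c - a) * R) :=
    Real.exp_le_exp.2 (mul_le_mul_of_nonneg_left hx.2 (by linarith))
  have hp0 : 0 < p := Real.exp_pos _
  have hq0 : 0 < q := Real.exp_pos _
  have key := hT.abs_le (u := g + (-φ x) • e a)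
    (v := (ε + K * (c - b)) • e a + (-(K * (c - a) * p)) • e b + (K * (b - a) * q) • e c)
    (hg.add (hea.smul _)) (((hea.smul _).add (heb.smul _)).add (hec.smul _))
    (fun t ht => by
      have h1 : e b t = Real.exp (-(b - a) * t) * e a t := by
        simp only [he, ← Real.exp_add]; ring_nf
      have h2 : e c t = Real.exp (-(c - a) * t) * e a t := by
        simp only [he, ← Real.exp_add]; ring_nf
      have h3 : Real.exp (-(b - a) * (t - x)) = p * Real.exp (-(b - a) * t) := by
        rw [hp, ← Real.exp_add]; ring_nf
      have h4 : Real.exp (-(c - a) * (t - x)) = q * Real.exp (-(c - a) * t) := by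
        rw [hq, ← Real.exp_add]; ring_nf
      have h5 : 0 < e a t := Real.exp_pos _
      have h6 := mul_le_mul_of_nonneg_right (hφ t ht) h5.le
      rw [← abs_of_pos h5, ← abs_mul, abs_of_pos h5, expBump, h3, h4] at h6
      simp only [Pi.add_apply, Pi.smul_apply, smul_eq_mul, hgφ t ht, h1, h2]
      refine (le_of_eq ?_).trans (h6.trans (le_of_eq ?_))
      · congr 1; simp only [he]; ring
      · ring) hx0
  rw [hT.add_smul hg hea _ hx0, hT.add_smul ((hea.smul _).add (heb.smul _)) hec _ hx0,
    hT.add_smul (hea.smul _) heb _ hx0, hT.smul _ _ hea _ hx0] at key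
  have da := hτ a (by simp)
  have db := hτ b (by simp)
  have dc := hτ c (by simp)
  change |T (e a) x - e a x| ≤ τ at da
  change |T (e b) x - e b x| ≤ τ at db
  change |T (e c) x - e c x| ≤ τ at dc
  have hτ0 : 0 ≤ τ := (abs_nonneg _).trans da
  have hpb : p * e b x = e a x := by simp only [he, hp, ← Real.exp_add]; ring_nf
  have hqc : q * e c x = e a x := by simp only [he, hq, ← Real.exp_add]; ring_nf
  have hea1 : e a x ≤ 1 := Real.exp_le_one_iff.2 (by nlinarith)
  have hgx : g x = φ x * e a x := hgφ x hx0
  have hsplit : T g x - g x = (T g x + -φ x * T (e a) x) + φ x * (T (e a) x - e a x) := by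
    rw [hgx]; ring
  have hφa : |φ x * (T (e a) x - e a x)| ≤ M * τ := by
    rw [abs_mul]
    exact mul_le_mul hM da (abs_nonneg _) ((abs_nonneg _).trans hM)
  have hb : -(p * (T (e b) x - e b x)) ≤ Real.exp ((b - a) * R) * τ := by
    have : -(T (e b) x - e b x) ≤ τ := (neg_le_abs _).trans db
    calc _ = p * -(T (e b) x - e b x) := by ring
      _ ≤ p * τ := mul_le_mul_of_nonneg_left this hp0.le
      _ ≤ _ := mul_le_mul_of_nonneg_right hpR hτ0
  have hc : q * (T (e c) x - e c x) ≤ Real.exp ((c - a) * R) * τ :=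
    (mul_le_mul_of_nonneg_left ((le_abs_self _).trans dc) hq0.le).trans
      (mul_le_mul_of_nonneg_right hqR hτ0)
  have ha' : T (e a) x - e a x ≤ τ := (le_abs_self _).trans da
  have hb' := mul_le_mul_of_nonneg_left hb (mul_nonneg hK (show 0 ≤ c - a by linarith))
  have hc' := mul_le_mul_of_nonneg_left hc (mul_nonneg hK (show 0 ≤ b - a by linarith))
  have ha'' := mul_le_mul_of_nonneg_left ha'
    (add_nonneg hε (mul_nonneg hK (show 0 ≤ c - b by linarith)))
  have hεa := mul_le_mul_of_nonneg_left hea1 hε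
  rw [hsplit]
  refine (abs_add_le _ _).trans ((add_le_add key hφa).trans ?_)
  have e1 : K * (c - a) * -(p * (T (e b) x - e b x)) =
      -(K * (c - a) * p) * T (e b) x + K * (c - a) * e a x := by rw [← hpb]; ring
  have e2 : K * (b - a) * (q * (T (e c) x - e c x)) =
      K * (b - a) * q * T (e c) x - K * (b - a) * e a x := by rw [← hqc]; ring
  rw [e1] at hb'
  rw [e2] at hc'
  linarith

/-- Korovkin convergence for functions dominated by `e^{-at}`. -/
lemma exists_forall_abs_sub_lt_of_le_exp {a b c : ℝ} (ha : 0 < a) (hab : a < b) (hbc : b < c)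
    {L : ℕ → (ℝ → ℝ) → (ℝ → ℝ)} (hL : ∀ n, IsPosLinear (L n))
    (hconv : ∀ l : ℝ, (l = a ∨ l = b ∨ l = c) →
      ∀ ε > (0 : ℝ), ∃ N : ℕ, ∀ n ≥ N, ∀ x ≥ (0 : ℝ),
        |L n (fun y => Real.exp (-l * y)) x - Real.exp (-l * x)| < ε)
    {g : ℝ → ℝ} (hg : CInfty g) {M : ℝ} (hM : ∀ t ≥ (0 : ℝ), |g t| ≤ M * Real.exp (-a * t))
    {ε : ℝ} (hε : 0 < ε) : ∃ N : ℕ, ∀ n ≥ N, ∀ x ≥ (0 : ℝ), |L n g x - g x| < ε := by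
  have hea := cInfty_exp_neg_mul ha
  have hM0 : 0 ≤ M := by simpa using (abs_nonneg _).trans (hM 0 le_rfl)
  obtain ⟨R, hR⟩ := eventually_atTop.1 (((hea.2.const_mul M).eventually_lt_const
    (show M * 0 < ε / 4 by linarith)))
  set φ : ℝ → ℝ := fun t => g t * Real.exp (a * t) with hφ
  have hexp (t : ℝ) : Real.exp (-a * t) * Real.exp (a * t) = 1 := by
    rw [← Real.exp_add]; simp
  have hφc : ContinuousOn φ (Set.Ici 0) := hg.1.mul (by fun_prop)
  have hφM : ∀ t ≥ (0 : ℝ), |φ t| ≤ M := fun t ht => by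
    have := mul_le_mul_of_nonneg_right (hM t ht) (Real.exp_pos (a * t)).le
    rw [mul_assoc, hexp, mul_one] at this
    rwa [hφ, abs_mul, abs_of_pos (Real.exp_pos (a * t))]
  have hgφ : ∀ t ≥ (0 : ℝ), g t = φ t * Real.exp (-a * t) := fun t _ => by
    rw [hφ, mul_assoc, mul_comm (Real.exp (a * t)), hexp, mul_one]
  obtain ⟨K, hK, hKφ⟩ := exists_abs_sub_le_expBump (sub_pos.2 hab)
    (show b - a < c - a by linarith) hφc hφM R (half_pos hε)
  set B := ε / 2 + M + K * ((c - b) + (c - a) * Real.exp ((b - a) * R) +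
      (b - a) * Real.exp ((c - a) * R)) with hB
  have hbump : 0 ≤ (c - b) + (c - a) * Real.exp ((b - a) * R) +
      (b - a) * Real.exp ((c - a) * R) :=
    add_nonneg (add_nonneg (by linarith) (mul_nonneg (by linarith) (Real.exp_pos _).le))
      (mul_nonneg (by linarith) (Real.exp_pos _).le)
  have hB0 : 0 < B := by
    have := mul_nonneg hK hbump
    linarith
  have hMB : M < B := by
    have := mul_nonneg hK hbump
    linarith
  have hτ : 0 < ε / (2 * B) := by positivity
  have hτB : ε / (2 * B) * B = ε / 2 := by field_simp
  obtain ⟨N₁, hN₁⟩ := hconv a (by simp) _ hτ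
  obtain ⟨N₂, hN₂⟩ := hconv b (by simp) _ hτ
  obtain ⟨N₃, hN₃⟩ := hconv c (by simp) _ hτ
  refine ⟨max N₁ (max N₂ N₃), fun n hn x hx => ?_⟩
  have hn₁ : N₁ ≤ n := (le_max_left _ _).trans hn
  have hn₂ : N₂ ≤ n := (le_max_left _ _).trans ((le_max_right _ _).trans hn)
  have hn₃ : N₃ ≤ n := (le_max_right _ _).trans ((le_max_right _ _).trans hn)
  have hτM : M * (ε / (2 * B)) < ε / 2 := by
    have := mul_lt_mul_of_pos_left hMB hτ
    linarith
  rcases le_total x R with hxR | hxR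
  · have hsharp : ∃ τ < ε / (2 * B), ∀ l, (l = a ∨ l = b ∨ l = c) →
        |L n (fun y => Real.exp (-l * y)) x - Real.exp (-l * x)| ≤ τ := by
      refine ⟨_, max_lt (hN₁ n hn₁ x hx) (max_lt (hN₂ n hn₂ x hx) (hN₃ n hn₃ x hx)), ?_⟩
      rintro l (rfl | rfl | rfl) <;> simp
    obtain ⟨τ, hτlt, hτle⟩ := hsharp
    have h := (hL n).abs_sub_le ha hab hbc hg hgφ (half_pos hε).le hK ⟨hx, hxR⟩ (hφM x hx)
      (hKφ x ⟨hx, hxR⟩) hτle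
    rw [← hB] at h
    have := mul_lt_mul_of_pos_right hτlt hB0
    linarith
  · have h1 : |L n g x| ≤ M * L n (fun y => Real.exp (-a * y)) x := by
      rw [← (hL n).smul M _ hea x hx]
      exact (hL n).abs_le hg (hea.smul M) hM hx
    have h2 := mul_le_mul_of_nonneg_left (abs_lt.1 (hN₁ n hn₁ x hx)).2.le hM0
    have h3 := hR x hxR
    have h4 := abs_sub (L n g x) (g x)
    have h5 := hM x hx
    linarith

/-- A function of `C_∞([0,∞))` is uniformly close to one dominated by `e^{-at}`. -/
lemma CInfty.exists_approx_le_exp {f : ℝ → ℝ} (hf : CInfty f) (a : ℝ) {ε : ℝ} (hε : 0 < ε) :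
    ∃ g, CInfty g ∧ (∀ t ≥ (0 : ℝ), |f t - g t| ≤ ε) ∧
      ∃ M, ∀ t ≥ (0 : ℝ), |g t| ≤ M * Real.exp (-a * t) := by
  set g : ℝ → ℝ := fun t => f t - max (-ε) (min ε (f t)) with hg
  have hgc : ContinuousOn g (Set.Ici 0) :=
    hf.1.sub (continuousOn_const.sup (continuousOn_const.inf hf.1))
  have hzero : ∀ t, |f t| < ε → g t = 0 := fun t ht => by
    obtain ⟨h1, h2⟩ := abs_lt.1 ht
    simp only [hg]
    rw [min_eq_right h2.le, max_eq_right h1.le, sub_self]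
  obtain ⟨R, hR⟩ := eventually_atTop.1 (hf.2.abs.eventually_lt_const
    (show |(0 : ℝ)| < ε by simpa using hε))
  refine ⟨g, ⟨hgc, ?_⟩, fun t _ => ?_, ?_⟩
  · refine tendsto_const_nhds.congr' ?_
    filter_upwards [eventually_ge_atTop R] with t ht
    exact (hzero t (hR t ht)).symm
  · simp only [hg, sub_sub_cancel]
    exact abs_le.2 ⟨le_max_left _ _, max_le (by linarith) (min_le_left _ _)⟩
  · have hc : ContinuousOn (fun t => g t * Real.exp (a * t)) (Set.Icc 0 R) :=
      (hgc.mono Set.Icc_subset_Ici_self).mul (by fun_prop)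
    obtain ⟨M, hM⟩ := isCompact_Icc.exists_bound_of_continuousOn hc
    refine ⟨max M 0, fun t ht => ?_⟩
    rcases le_total t R with htR | htR
    · have h := hM t ⟨ht, htR⟩
      rw [Real.norm_eq_abs, abs_mul, abs_of_pos (Real.exp_pos _)] at h
      have h' := mul_le_mul_of_nonneg_right (h.trans (le_max_left M 0))
        (Real.exp_pos (-a * t)).le
      rwa [mul_assoc, ← Real.exp_add, neg_mul, add_neg_cancel, Real.exp_zero, mul_one,
        ← neg_mul] at h'
    · rw [hzero t (hR t htR), abs_zero]
      positivity

lemma supnorm_le {f : ℝ → ℝ} {c : ℝ} (h : ∀ t ≥ (0 : ℝ), |f t| ≤ c) : supnorm f ≤ c :=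
  haveI : Nonempty (Set.Ici (0 : ℝ)) := ⟨⟨0, Set.self_mem_Ici⟩⟩
  ciSup_le fun t => h t t.2

lemma supnorm_nonneg (f : ℝ → ℝ) : 0 ≤ supnorm f :=
  Real.iSup_nonneg fun _ => abs_nonneg _

/-- **A Korovkin-type theorem on `C_∞([0,∞))`.**  Let `0 < λ₁ < λ₂ < λ₃` and
`f_λ(x) = e^{−λx}`.  If `(Lₙ)` is a uniformly bounded sequence of positive linear operators on
`C_∞([0,∞))` with `‖Lₙ f_{λ_k} − f_{λ_k}‖_∞ → 0` for `k = 1,2,3`, then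
`‖Lₙ f − f‖_∞ → 0` for every `f ∈ C_∞([0,∞))`. -/
theorem korovkin_exponential (lam₁ lam₂ lam₃ : ℝ)
    (h₁ : 0 < lam₁) (h₁₂ : lam₁ < lam₂) (h₂₃ : lam₂ < lam₃)
    (L : ℕ → (ℝ → ℝ) → (ℝ → ℝ))
    (hmaps : ∀ n f, CInfty f → CInfty (L n f))
    (hadd : ∀ n f g, CInfty f → CInfty g → ∀ x ≥ (0 : ℝ),
      L n (f + g) x = L n f x + L n g x)
    (hsmul : ∀ n (c : ℝ) f, CInfty f → ∀ x ≥ (0 : ℝ), L n (c • f) x = c * L n f x)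
    (hpos : ∀ n f, CInfty f → (∀ x ≥ (0 : ℝ), 0 ≤ f x) → ∀ x ≥ (0 : ℝ), 0 ≤ L n f x)
    (C : ℝ) (hbdd : ∀ n f, CInfty f → ∀ x ≥ (0 : ℝ), |L n f x| ≤ C * supnorm f)
    (hconv : ∀ lam : ℝ, (lam = lam₁ ∨ lam = lam₂ ∨ lam = lam₃) →
      ∀ ε > (0 : ℝ), ∃ N : ℕ, ∀ n ≥ N, ∀ x ≥ (0 : ℝ),
        |L n (fun y => Real.exp (-lam * y)) x - Real.exp (-lam * x)| < ε) :
    ∀ f, CInfty f → ∀ ε > (0 : ℝ), ∃ N : ℕ, ∀ n ≥ N, ∀ x ≥ (0 : ℝ),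
      |L n f x - f x| < ε := by
  intro f hf ε hε
  have hL : ∀ n, IsPosLinear (L n) := fun n => ⟨hadd n, hsmul n, hpos n⟩
  set η := ε / (2 * (|C| + 1)) with hη
  have hη0 : 0 < η := by positivity
  have hηC : η * (|C| + 1) = ε / 2 := by
    rw [hη]; field_simp
  obtain ⟨g, hg, hfg, M, hM⟩ := hf.exists_approx_le_exp lam₁ hη0
  obtain ⟨N, hN⟩ := exists_forall_abs_sub_lt_of_le_exp h₁ h₁₂ h₂₃ hL hconv hg hM (half_pos hε)
  refine ⟨N, fun n hn x hx => ?_⟩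
  have hd := hbdd n (f + (-1 : ℝ) • g) (hf.add (hg.smul _)) x hx
  have hsup : supnorm (f + (-1 : ℝ) • g) ≤ η := supnorm_le fun t ht => by
    simpa [← sub_eq_add_neg] using hfg t ht
  rw [(hL n).add_smul hf hg _ hx] at hd
  have h1 : C * supnorm (f + (-1 : ℝ) • g) ≤ |C| * η :=
    mul_le_mul (le_abs_self C) hsup (supnorm_nonneg _) (abs_nonneg C)
  have h2 := abs_le.1 (hd.trans h1)
  have h3 := abs_lt.1 (hN n hn x hx)
  have h4 := abs_le.1 (hfg x hx)
  rw [abs_lt]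
  constructor <;> linarith [h2.1, h2.2, h3.1, h3.2, h4.1, h4.2]
end
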